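/- (Theorem 4: conditional central limit theorem.) Under the setup below, with ρ < 1, δ < 1 and α + β > 1, for every fixed integer k ≥ 0 and all reals a, b: lim_{n→∞} P_n({(k,i₁,i₂) : i₁ ≤ m₁ + a√n and i₂ ≤ m₂ + b√n}) / P_n({(k,i₁,i₂) : all i₁,i₂}) = ∫_{−∞}^{a} ∫_{−∞}^{b} (2πσ₁σ₂√(1−r²))^{−1} exp( −(x²/σ₁² − 2rxy/(σ₁σ₂) + y²/σ₂²)/(2(1−r²)) ) dy dx, where m₁ = T_n n₁/(T_n + 1/μ₁), m₂ = T_n n₂/(T_n + 1/μ₂), T_n is the unique positive root of 1 = (n₁/λ)(1/μ₁+T)^{−1} + (n₂/λ)(1/μ₂+T)^{−1}, σ₁² = (θ−f₁)f₁((1−θ)f₁+f₂²)/(θf₂²+(1−θ)f₁²), σ₂² = (1−θ−f₂)f₂(θf₂+f₁²)/(θf₂²+(1−θ)f₁²), and r = √((θ−f₁)(1−θ−f₂)f₁f₂/((θf₂+f₁²)((1−θ)f₁+f₂²))). -/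

import Mathlib

open Filter

/-- Number of pool-1 (flexible) servers for system size `n`. -/
noncomputable def Npool1 (θ : ℝ) (n : ℕ) : ℕ := ⌈θ * n⌉₊

/-- Number of pool-2 servers for system size `n`. -/
noncomputable def Npool2 (θ : ℝ) (n : ℕ) : ℕ := n - Npool1 θ n

/-- Total arrival rate for system size `n`. -/
noncomputable def Nlam (μ₁ μ₂ θ ρ : ℝ) (n : ℕ) : ℝ :=
  ρ * ((Npool1 θ n : ℝ) * μ₁ + (Npool2 θ n : ℝ) * μ₂)

/-- Unnormalized stationary weight `w_n(k, i₁, i₂)` of the FCFS-ALIS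
many-server N-system, where `k` is the number of pool-2 servers following the
last pool-1 server among the idle servers and `i₁`, `i₂` are the numbers of
idle pool-1, pool-2 servers. -/
noncomputable def Nwt (μ₁ μ₂ θ ρ α : ℝ) (n : ℕ) : ℕ × ℕ × ℕ → ℝ := fun t =>
  let k := t.1
  let i₁ := t.2.1
  let i₂ := t.2.2
  let n₁ := Npool1 θ n
  let n₂ := Npool2 θ n
  let lam := Nlam μ₁ μ₂ θ ρ n
  let lam₁ := α * lam
  let lam₂ := (1 - α) * lam
  if k ≤ n₂ ∧ 1 ≤ i₁ ∧ i₁ ≤ n₁ ∧ k ≤ i₂ ∧ i₂ ≤ n₂ then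
    (n₁.choose i₁ : ℝ) * (n₂.choose i₂ : ℝ) * (i₁ : ℝ) *
      ((i₁ + i₂ - k - 1).factorial : ℝ) * ((i₂.factorial : ℝ) / ((i₂ - k).factorial : ℝ)) *
      μ₁ ^ i₁ * μ₂ ^ i₂ * (lam ^ (i₁ + i₂))⁻¹ * (lam / lam₁) ^ k
  else if 1 ≤ k ∧ k ≤ n₂ ∧ i₁ = 0 ∧ 1 ≤ i₂ ∧ i₂ ≤ k then
    (n₁ : ℝ) * ((n₂.factorial : ℝ) / ((n₂ - k).factorial : ℝ)) * μ₁ * μ₂ ^ k *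
      (lam₁ ^ i₂)⁻¹ *
      ∏ j ∈ Finset.Icc (n - k) (n - i₂), (μ₁ * (n₁ : ℝ) + μ₂ * ((j : ℝ) - (n₁ : ℝ)) - lam₂)⁻¹
  else if k ≤ n₂ ∧ i₁ = 0 ∧ i₂ = 0 then
    (n₁ : ℝ) * ((n₂.factorial : ℝ) / ((n₂ - k).factorial : ℝ)) * μ₁ * μ₂ ^ k *
      (μ₁ * (n₁ : ℝ) + μ₂ * (n₂ : ℝ) - lam)⁻¹ *
      ∏ j ∈ Finset.Icc (n - k) (n - 1), (μ₁ * (n₁ : ℝ) + μ₂ * ((j : ℝ) - (n₁ : ℝ)) - lam₂)⁻¹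
  else 0

/-- Stationary probability of the event `E` of triples `(k, i₁, i₂)` for the
FCFS-ALIS many-server N-system of size `n`. -/
noncomputable def NP (μ₁ μ₂ θ ρ α : ℝ) (n : ℕ) (E : Set (ℕ × ℕ × ℕ)) : ℝ :=
  (∑' t : E, Nwt μ₁ μ₂ θ ρ α n t) / (∑' t : ℕ × ℕ × ℕ, Nwt μ₁ μ₂ θ ρ α n t)

open MeasureTheory


/-- A subgaussian-type bound for `(1 + x) e^{-x}` on `[-1, ∞)`. -/
lemma one_add_mul_exp_neg_le {x : ℝ} (hx : -1 ≤ x) :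
    (1 + x) * Real.exp (-x) ≤ Real.exp (-(x ^ 2 / (4 * (1 + |x|)))) := by
  have h0 : 0 ≤ 1 + x := by linarith
  set s := Real.sqrt (1 + x) with hs
  have hs0 : 0 ≤ s := Real.sqrt_nonneg _
  have hs2 : s ^ 2 = 1 + x := Real.sq_sqrt h0
  have h1 : s ≤ Real.exp (s - 1) := by
    have := Real.add_one_le_exp (s - 1); linarith
  have h2 : 1 + x ≤ Real.exp (2 * (s - 1)) := by
    rw [← hs2, two_mul, Real.exp_add, sq]
    exact mul_self_le_mul_self hs0 h1
  have hpos : 0 < 1 + |x| := by positivity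
  have h3 : x ^ 2 / (4 * (1 + |x|)) ≤ (s - 1) ^ 2 := by
    rw [div_le_iff₀ (by positivity)]
    have hx' : x = (s - 1) * (s + 1) := by nlinarith
    have h4 : (s + 1) ^ 2 ≤ 4 * (1 + |x|) := by
      have := le_abs_self x
      nlinarith [sq_nonneg (s - 1), abs_nonneg x]
    calc x ^ 2 = (s - 1) ^ 2 * (s + 1) ^ 2 := by rw [← mul_pow, ← hx']
      _ ≤ _ := by gcongr
  calc (1 + x) * Real.exp (-x) ≤ Real.exp (2 * (s - 1)) * Real.exp (-x) := by gcongr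
    _ = Real.exp (2 * (s - 1) - x) := by rw [← Real.exp_add]; ring_nf
    _ ≤ _ := by
      apply Real.exp_le_exp.2
      nlinarith

lemma tendsto_exp_taylor_two {x : ℕ → ℂ} (c : ℂ) {ε : ℕ → ℝ} (hε : Tendsto ε atTop (nhds 0))
    (hε0 : ∀ᶠ n in atTop, ε n ≠ 0) {c' : ℕ → ℂ} (hc : Tendsto c' atTop (nhds c))
    (hx : ∀ n, x n = ε n * c' n) :
    Tendsto (fun n => (Complex.exp (x n) - (1 + x n + x n ^ 2 / 2)) / (ε n : ℂ) ^ 2) atTop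
      (nhds 0) := by
  have hεc : Tendsto (fun n => (ε n : ℂ)) atTop (nhds 0) := by
    simpa [Function.comp_def] using (Complex.continuous_ofReal.tendsto 0).comp hε
  have hx0 : Tendsto x atTop (nhds 0) := by
    have := hεc.mul hc
    simpa [funext hx] using this
  have hb : Tendsto (fun n => ‖(ε n : ℂ)‖ * ‖c' n‖ ^ 3 * Real.exp ‖x n‖) atTop (nhds 0) := by
    have := (hεc.norm.mul (hc.norm.pow 3)).mul ((Real.continuous_exp.tendsto _).comp hx0.norm)
    simpa using this
  refine squeeze_zero_norm' ?_ hb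
  filter_upwards [hε0] with n hn
  have h := Complex.norm_exp_sub_sum_le_norm_mul_exp (x n) 3
  have hs : ∑ m ∈ Finset.range 3, x n ^ m / (m.factorial : ℂ) = 1 + x n + x n ^ 2 / 2 := by
    simp [Finset.sum_range_succ, Nat.factorial]
  rw [hs] at h
  have hp : 0 < ‖(ε n : ℂ)‖ := by simpa using hn
  rw [norm_div, norm_pow, div_le_iff₀ (by positivity)]
  refine h.trans (le_of_eq ?_)
  nth_rewrite 1 [hx n]
  rw [norm_mul]
  ring

/-- The normalised generating function of a shifted binomial count. -/
noncomputable def tiltFactor (N j : ℕ) (p ε ξ u : ℝ) : ℂ :=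
  Complex.exp (-((N + j) * p * ε * (u + ξ * Complex.I))) *
    (1 + p * ((1 + ε * u) * Complex.exp (ε * ξ * Complex.I) - 1)) ^ N *
    Complex.exp (ε * ξ * j * Complex.I)

lemma tendsto_one_add_pow_of_tendsto_ratio {N : ℕ → ℕ} {c : ℝ} {g : ℕ → ℂ} {t : ℂ}
    (hN : Tendsto (fun n => (N n : ℝ) / n) atTop (nhds c))
    (hg : Tendsto (fun n : ℕ => (n : ℂ) * g n) atTop (nhds t)) :
    Tendsto (fun n => (1 + g n) ^ N n) atTop (nhds (Complex.exp (c * t))) := by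
  have hlog := Complex.tendsto_nat_mul_log_one_add_of_tendsto hg
  have hNc : Tendsto (fun n => (((N n : ℝ) / n : ℝ) : ℂ)) atTop (nhds (c : ℂ)) :=
    (Complex.continuous_ofReal.tendsto c).comp hN
  have hmul := (Complex.continuous_exp.tendsto _).comp (hNc.mul hlog)
  refine hmul.congr' ?_
  have hg0 : Tendsto g atTop (nhds 0) := by
    have hinv : Tendsto (fun n : ℕ => ((n : ℂ))⁻¹) atTop (nhds 0) :=
      tendsto_inv_atTop_nhds_zero_nat
    have := hinv.mul hg
    rw [zero_mul] at this
    refine this.congr' ?_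
    filter_upwards [eventually_gt_atTop 0] with n hn
    have : (n : ℂ) ≠ 0 := by exact_mod_cast hn.ne'
    field_simp
  have hne : ∀ᶠ n in atTop, 1 + g n ≠ 0 := by
    have h1 : Tendsto (fun n => 1 + g n) atTop (nhds 1) := by simpa using hg0.const_add 1
    exact h1.eventually_ne one_ne_zero
  filter_upwards [hne, eventually_gt_atTop 0] with n hn hn0
  have hn' : (n : ℂ) ≠ 0 := by exact_mod_cast hn0.ne'
  have : (((N n : ℝ) / n : ℝ) : ℂ) * ((n : ℂ) * Complex.log (1 + g n))
      = N n * Complex.log (1 + g n) := by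
    push_cast; field_simp
  simp only [Function.comp, this]
  rw [Complex.exp_nat_mul, Complex.exp_log hn]

lemma tendsto_inv_sqrt_nat : Tendsto (fun n : ℕ => (Real.sqrt n)⁻¹) atTop (nhds 0) :=
  tendsto_inv_atTop_zero.comp (Real.tendsto_sqrt_atTop.comp tendsto_natCast_atTop_atTop)

lemma tendsto_tiltFactor {N : ℕ → ℕ} {c P : ℝ} {p : ℕ → ℝ} (j : ℕ)
    (hN : Tendsto (fun n => (N n : ℝ) / n) atTop (nhds c))
    (hp : Tendsto p atTop (nhds P)) (ξ u : ℝ) :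
    Tendsto (fun n : ℕ => tiltFactor (N n) j (p n) (Real.sqrt n)⁻¹ ξ u) atTop
      (nhds (Complex.exp (c * (P * (1 - P) * (u + ξ * Complex.I) ^ 2 - P * u ^ 2) / 2))) := by
  set ε : ℕ → ℝ := fun n => (Real.sqrt n)⁻¹ with hεdef
  have hε : Tendsto ε atTop (nhds 0) := tendsto_inv_sqrt_nat
  have hε0 : ∀ᶠ n in atTop, ε n ≠ 0 := by
    filter_upwards [eventually_gt_atTop 0] with n hn
    have : (0 : ℝ) < n := by exact_mod_cast hn
    simp only [hεdef]; positivity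
  have hεc : Tendsto (fun n => (ε n : ℂ)) atTop (nhds 0) := by
    simpa [Function.comp_def] using (Complex.continuous_ofReal.tendsto 0).comp hε
  have hpc : Tendsto (fun n => (p n : ℂ)) atTop (nhds P) :=
    (Complex.continuous_ofReal.tendsto P).comp hp
  set w : ℂ := u + ξ * Complex.I with hw
  have h1 := tendsto_exp_taylor_two (x := fun n => ε n * (ξ * Complex.I)) (ξ * Complex.I) hε hε0
    tendsto_const_nhds (fun n => rfl)
  have h2 := tendsto_exp_taylor_two (x := fun n => ε n * (-(p n * w))) (-(P * w)) hε hε0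
    (hpc.mul_const w).neg (fun n => rfl)
  set r₁ : ℕ → ℂ := fun n => (Complex.exp (ε n * (ξ * Complex.I)) -
    (1 + ε n * (ξ * Complex.I) + (ε n * (ξ * Complex.I)) ^ 2 / 2)) / (ε n : ℂ) ^ 2 with hr₁
  set r₂ : ℕ → ℂ := fun n => (Complex.exp (ε n * (-(p n * w))) -
    (1 + ε n * (-(p n * w)) + (ε n * (-(p n * w))) ^ 2 / 2)) / (ε n : ℂ) ^ 2 with hr₂
  set g : ℕ → ℂ := fun n => Complex.exp (ε n * (-(p n * w))) *
    (1 + p n * ((1 + ε n * u) * Complex.exp (ε n * (ξ * Complex.I)) - 1)) - 1 with hg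
  set G : ℂ × ℂ × ℂ × ℂ → ℂ := fun q =>
    let e := q.1
    let π := q.2.1
    let s := q.2.2.1
    let t := q.2.2.2
    let y : ℂ := ξ * Complex.I
    let A := π * (u * y + y ^ 2 / 2 + s + e * u * (y ^ 2 / 2 + s))
    let B := π ^ 2 * w ^ 2 / 2 + t
    A + B - π ^ 2 * w ^ 2 + e * (-(π * w) * A + B * π * w) + e ^ 2 * A * B with hG
  have hGc : Continuous G := by simp only [hG]; fun_prop
  have hlim : Tendsto (fun n => G (ε n, p n, r₁ n, r₂ n)) atTop (nhds (G (0, P, 0, 0))) :=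
    (hGc.tendsto _).comp (hεc.prodMk_nhds (hpc.prodMk_nhds (h1.prodMk_nhds h2)))
  have hng : Tendsto (fun n : ℕ => (n : ℂ) * g n) atTop (nhds (G (0, P, 0, 0))) := by
    refine hlim.congr' ?_
    filter_upwards [hε0] with n hn
    have hn' : (ε n : ℂ) ≠ 0 := by exact_mod_cast hn
    have hnn : (n : ℂ) = ((ε n : ℂ) ^ 2)⁻¹ := by
      simp only [hεdef]
      rw [← Complex.ofReal_pow, ← Complex.ofReal_inv, inv_pow, Real.sq_sqrt (by positivity)]
      simp
    have e1 : Complex.exp (ε n * (ξ * Complex.I)) =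
        1 + ε n * (ξ * Complex.I) + (ε n * (ξ * Complex.I)) ^ 2 / 2 + r₁ n * (ε n : ℂ) ^ 2 := by
      simp only [hr₁]; field_simp; ring
    have e2 : Complex.exp (ε n * (-(p n * w))) =
        1 + ε n * (-(p n * w)) + (ε n * (-(p n * w))) ^ 2 / 2 + r₂ n * (ε n : ℂ) ^ 2 := by
      simp only [hr₂]; field_simp; ring
    rw [hnn]
    simp only [hg]
    rw [e1, e2, eq_inv_mul_iff_mul_eq₀ (pow_ne_zero 2 hn')]
    simp only [hG]
    generalize r₁ n = s
    generalize r₂ n = t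
    generalize (p n : ℂ) = π
    generalize (ε n : ℂ) = e
    rw [hw]
    ring
  have hpow := tendsto_one_add_pow_of_tendsto_ratio hN hng
  have hside : Tendsto (fun n => Complex.exp (-(j * p n * ε n * w)) *
      Complex.exp (ε n * ξ * j * Complex.I)) atTop (nhds 1) := by
    have hc : Continuous (fun q : ℂ × ℂ => Complex.exp (-(j * q.1 * q.2 * w)) *
      Complex.exp (q.2 * ξ * j * Complex.I)) := by fun_prop
    have := (hc.tendsto ((P : ℂ), (0 : ℂ))).comp (hpc.prodMk_nhds hεc)
    simpa [Function.comp_def] using this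
  have hfin := hpow.mul hside
  rw [mul_one] at hfin
  have hval : (c : ℂ) * G (0, P, 0, 0)
      = c * (P * (1 - P) * w ^ 2 - P * u ^ 2) / 2 := by
    simp only [hG, hw]; ring
  rw [hval] at hfin
  refine hfin.congr fun n => ?_
  simp only [hg, tiltFactor]
  rw [add_sub_cancel, mul_pow, ← Complex.exp_nat_mul]
  have : Complex.exp (-((N n + j) * p n * ε n * w)) =
      Complex.exp (N n * (ε n * (-(p n * w)))) * Complex.exp (-(j * p n * ε n * w)) := by
    rw [← Complex.exp_add]; ring_nf
  rw [this]
  have : (ε n : ℂ) * ξ * Complex.I = ε n * (ξ * Complex.I) := by ring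
  rw [this]
  ring

lemma norm_tiltFactor_le {N : ℕ} (j : ℕ) {p ε : ℝ} (ξ : ℝ) {u : ℝ} (hp0 : 0 ≤ p) (hp1 : p ≤ 1)
    (hu : -1 ≤ ε * u) :
    ‖tiltFactor N j p ε ξ u‖ ≤
      Real.exp j * Real.exp (-(N * ((p * (ε * u)) ^ 2 / (4 * (1 + |p * (ε * u)|))))) := by
  have hx : -1 ≤ p * (ε * u) := by nlinarith
  have h1 : ‖(1 + p * ((1 + ε * u) * Complex.exp (ε * ξ * Complex.I) - 1) : ℂ)‖
      ≤ 1 + p * (ε * u) := by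
    have : (1 + p * ((1 + ε * u) * Complex.exp (ε * ξ * Complex.I) - 1) : ℂ) =
      ((1 - p : ℝ) : ℂ) + ((p * (1 + ε * u) : ℝ) : ℂ) * Complex.exp ((ε * ξ : ℝ) * Complex.I) := by
      push_cast; ring
    rw [this]
    refine (norm_add_le _ _).trans (le_of_eq ?_)
    rw [norm_mul, Complex.norm_exp_ofReal_mul_I, Complex.norm_real, Complex.norm_real,
      Real.norm_of_nonneg (by linarith), Real.norm_of_nonneg (mul_nonneg hp0 (by linarith))]
    ring
  have h2 : ‖Complex.exp (ε * ξ * j * Complex.I)‖ = 1 := by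
    have := Complex.norm_exp_ofReal_mul_I (ε * ξ * j)
    push_cast at this; exact this
  have h3 : ‖Complex.exp (-((N + j) * p * ε * (u + ξ * Complex.I)))‖
      = Real.exp (-(j * (p * (ε * u)))) * Real.exp (-(p * (ε * u))) ^ N := by
    rw [Complex.norm_exp, ← Real.exp_nat_mul, ← Real.exp_add]
    congr 1
    have : (-((N + j) * p * ε * (u + ξ * Complex.I)) : ℂ) =
      ((-((N + j) * p * ε * u) : ℝ) : ℂ) + ((-((N + j) * p * ε * ξ) : ℝ) : ℂ) * Complex.I := by
      push_cast; ring
    rw [this]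
    simp
    ring
  have h4 := one_add_mul_exp_neg_le hx
  rw [tiltFactor, norm_mul, norm_mul, norm_pow, h2, h3, mul_one]
  calc Real.exp (-(j * (p * (ε * u)))) * Real.exp (-(p * (ε * u))) ^ N * _ ^ N
      ≤ Real.exp j * Real.exp (-(p * (ε * u))) ^ N * (1 + p * (ε * u)) ^ N := by
        gcongr
        have : (0 : ℝ) ≤ j := by positivity
        nlinarith
    _ = Real.exp j * ((1 + p * (ε * u)) * Real.exp (-(p * (ε * u)))) ^ N := by
        rw [mul_pow]; ring
    _ ≤ Real.exp j * Real.exp (-((p * (ε * u)) ^ 2 / (4 * (1 + |p * (ε * u)|)))) ^ N := by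
        gcongr
        exact mul_nonneg (by linarith) (Real.exp_pos _).le
    _ = _ := by rw [← Real.exp_nat_mul]; ring_nf

lemma integrable_exp_neg_mul_abs {c : ℝ} (hc : 0 < c) :
    Integrable (fun u : ℝ => Real.exp (-(c * |u|))) := by
  rw [← integrableOn_univ, ← Set.Iic_union_Ioi (a := (0 : ℝ)), integrableOn_union]
  constructor
  · refine (integrableOn_exp_mul_Iic hc 0).congr_fun (fun u hu => ?_) measurableSet_Iic
    simp only [abs_of_nonpos (Set.mem_Iic.1 hu)]
    ring_nf
  · refine (integrableOn_exp_mul_Ioi (neg_lt_zero.2 hc) 0).congr_fun (fun u hu => ?_)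
      measurableSet_Ioi
    simp only [abs_of_pos (Set.mem_Ioi.1 hu)]
    ring_nf

/-- The rescaled integrand of the mixing integral, centred at the saddle point. -/
noncomputable def tiltIntegrand (N₁ N₂ j₁ j₂ : ℕ) (p₁ p₂ : ℝ) (n : ℕ) (ξ η u : ℝ) : ℂ :=
  Set.indicator (Set.Ioi (-Real.sqrt n)) (fun u =>
    tiltFactor N₁ j₁ p₁ (Real.sqrt n)⁻¹ ξ u * tiltFactor N₂ j₂ p₂ (Real.sqrt n)⁻¹ η u) u

lemma continuous_tiltFactor (N j : ℕ) (p ε ξ : ℝ) : Continuous (tiltFactor N j p ε ξ) := by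
  unfold tiltFactor; fun_prop

lemma exp_neg_tilt_le {N n : ℕ} {p c P u : ℝ} (hn : 0 < n) (hp1 : p ≤ 1) (hP : 0 < P)
    (hc : 0 < c) (hpP : P ≤ p) (hN : c ≤ (N : ℝ) / n) :
    Real.exp (-(N * ((p * ((Real.sqrt n)⁻¹ * u)) ^ 2 /
      (4 * (1 + |p * ((Real.sqrt n)⁻¹ * u)|)))))
      ≤ Real.exp (c * P ^ 2 / 4) * Real.exp (-(c * P ^ 2 / 4 * |u|)) := by
  have hn1 : (1 : ℝ) ≤ n := by exact_mod_cast hn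
  have hs1 : 1 ≤ Real.sqrt n := Real.one_le_sqrt.2 hn1
  set ε := (Real.sqrt n)⁻¹ with hε
  have hε0 : 0 < ε := by positivity
  have hε1 : ε ≤ 1 := inv_le_one_of_one_le₀ hs1
  have hε2 : ε ^ 2 = (n : ℝ)⁻¹ := by rw [hε, inv_pow, Real.sq_sqrt (by positivity)]
  have hp0 : 0 < p := hP.trans_le hpP
  rw [← Real.exp_add]
  apply Real.exp_le_exp.2
  have habs : |p * (ε * u)| ≤ |u| := by
    rw [abs_mul, abs_mul, abs_of_pos hp0, abs_of_pos hε0]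
    have : ε * |u| ≤ |u| := mul_le_of_le_one_left (abs_nonneg u) hε1
    exact (mul_le_of_le_one_left (by positivity) hp1).trans this
  have hsq : N * (p * (ε * u)) ^ 2 = (N : ℝ) / n * p ^ 2 * u ^ 2 := by
    rw [mul_pow, mul_pow, hε2]; ring
  have h1 : c * P ^ 2 * (|u| - 1) ≤ N * (p * (ε * u)) ^ 2 / (1 + |p * (ε * u)|) := by
    rw [le_div_iff₀ (by positivity), hsq]
    have h2 : c * P ^ 2 ≤ (N : ℝ) / n * p ^ 2 := by gcongr
    rcases le_total |u| 1 with h | h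
    · have : c * P ^ 2 * (|u| - 1) * (1 + |p * (ε * u)|) ≤ 0 :=
        mul_nonpos_of_nonpos_of_nonneg
          (mul_nonpos_of_nonneg_of_nonpos (by positivity) (by linarith)) (by positivity)
      refine this.trans (by positivity)
    · calc c * P ^ 2 * (|u| - 1) * (1 + |p * (ε * u)|)
          ≤ c * P ^ 2 * (|u| - 1) * (1 + |u|) := by
            have : 0 ≤ |u| - 1 := by linarith
            gcongr
        _ = c * P ^ 2 * (u ^ 2 - 1) := by rw [← sq_abs u]; ring
        _ ≤ c * P ^ 2 * u ^ 2 := by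
            have : 0 ≤ c * P ^ 2 := by positivity
            nlinarith
        _ ≤ _ := by gcongr
  have h3 : N * ((p * (ε * u)) ^ 2 / (4 * (1 + |p * (ε * u)|)))
      = (N * (p * (ε * u)) ^ 2 / (1 + |p * (ε * u)|)) / 4 := by
    field_simp
  rw [h3]
  linarith

lemma norm_tiltFactor_mul_le {N₁ N₂ j₁ j₂ n : ℕ} {p₁ p₂ c P u : ℝ} (ξ η : ℝ) (hn : 0 < n)
    (hp1 : p₁ ≤ 1) (hP : 0 < P) (hc : 0 < c) (hpP : P ≤ p₁) (hN : c ≤ (N₁ : ℝ) / n)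
    (hp₂ : 0 ≤ p₂) (hp₂' : p₂ ≤ 1) (hu : -Real.sqrt n ≤ u) :
    ‖tiltFactor N₁ j₁ p₁ (Real.sqrt n)⁻¹ ξ u * tiltFactor N₂ j₂ p₂ (Real.sqrt n)⁻¹ η u‖ ≤
      Real.exp j₁ * Real.exp j₂ * Real.exp (c * P ^ 2 / 4) *
        Real.exp (-(c * P ^ 2 / 4 * |u|)) := by
  have hn1 : (1 : ℝ) ≤ n := by exact_mod_cast hn
  have hs : 0 < Real.sqrt n := by positivity
  have hu' : -1 ≤ (Real.sqrt n)⁻¹ * u := by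
    rw [← div_eq_inv_mul, le_div_iff₀ hs]; linarith
  rw [norm_mul]
  have h1 := norm_tiltFactor_le (N := N₁) j₁ ξ (hP.le.trans hpP) hp1 hu'
  have h2 := norm_tiltFactor_le (N := N₂) j₂ η hp₂ hp₂' hu'
  have h3 := exp_neg_tilt_le (u := u) hn hp1 hP hc hpP hN
  have h4 : Real.exp (-(N₂ * ((p₂ * ((Real.sqrt n)⁻¹ * u)) ^ 2 /
      (4 * (1 + |p₂ * ((Real.sqrt n)⁻¹ * u)|))))) ≤ 1 := by
    rw [Real.exp_le_one_iff, neg_nonpos]; positivity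
  calc _ ≤ (Real.exp j₁ * (Real.exp (c * P ^ 2 / 4) * Real.exp (-(c * P ^ 2 / 4 * |u|)))) *
        (Real.exp j₂ * 1) := by
        refine mul_le_mul (h1.trans ?_) (h2.trans ?_) (norm_nonneg _) (by positivity)
        · gcongr
        · gcongr
    _ = _ := by ring

lemma tendsto_integral_tiltIntegrand {N₁ N₂ : ℕ → ℕ} {p₁ p₂ : ℕ → ℝ} {c₁ c₂ P₁ P₂ : ℝ}
    (j₁ j₂ : ℕ) (hc₁ : 0 < c₁) (hP₁ : P₁ ∈ Set.Ioo 0 1) (hP₂ : P₂ ∈ Set.Ioo 0 1)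
    (hN₁ : Tendsto (fun n => (N₁ n : ℝ) / n) atTop (nhds c₁))
    (hN₂ : Tendsto (fun n => (N₂ n : ℝ) / n) atTop (nhds c₂))
    (hp₁ : Tendsto p₁ atTop (nhds P₁)) (hp₂ : Tendsto p₂ atTop (nhds P₂)) (ξ η : ℝ) :
    Tendsto (fun n => ∫ u, tiltIntegrand (N₁ n) (N₂ n) j₁ j₂ (p₁ n) (p₂ n) n ξ η u) atTop
      (nhds (∫ u : ℝ,
        Complex.exp (c₁ * (P₁ * (1 - P₁) * (u + ξ * Complex.I) ^ 2 - P₁ * u ^ 2) / 2) *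
        Complex.exp (c₂ * (P₂ * (1 - P₂) * (u + η * Complex.I) ^ 2 - P₂ * u ^ 2) / 2))) := by
  refine tendsto_integral_filter_of_dominated_convergence
    (fun u => Real.exp j₁ * Real.exp j₂ * Real.exp (c₁ / 2 * (P₁ / 2) ^ 2 / 4) *
        Real.exp (-(c₁ / 2 * (P₁ / 2) ^ 2 / 4 * |u|))) ?_ ?_ ?_ ?_
  · refine Eventually.of_forall fun n => ?_
    exact (((continuous_tiltFactor _ _ _ _ _).mul
      (continuous_tiltFactor _ _ _ _ _)).stronglyMeasurable.indicator
        measurableSet_Ioi).aestronglyMeasurable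
  · filter_upwards [eventually_gt_atTop 0, hp₁.eventually_le_const hP₁.2,
      hp₁.eventually_const_le (half_lt_self hP₁.1), hN₁.eventually_const_le (half_lt_self hc₁),
      hp₂.eventually_le_const hP₂.2, hp₂.eventually_const_le hP₂.1] with n hn h1 h2 h3 h4 h5
    refine Eventually.of_forall fun u => ?_
    unfold tiltIntegrand
    rw [Set.indicator_apply]
    split_ifs with hu
    · exact norm_tiltFactor_mul_le ξ η hn h1 (half_pos hP₁.1) (half_pos hc₁) h2 h3 h5 h4
        (le_of_lt hu)
    · rw [norm_zero]; positivity
  · have := hP₁.1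
    exact (integrable_exp_neg_mul_abs (by positivity)).const_mul _
  · refine Eventually.of_forall fun u => ?_
    refine ((tendsto_tiltFactor j₁ hN₁ hp₁ ξ u).mul (tendsto_tiltFactor j₂ hN₂ hp₂ η u)).congr' ?_
    have : Tendsto (fun n : ℕ => -Real.sqrt n) atTop atBot :=
      tendsto_neg_atTop_atBot.comp (Real.tendsto_sqrt_atTop.comp tendsto_natCast_atTop_atTop)
    filter_upwards [this.eventually_lt_atBot u] with n hn
    unfold tiltIntegrand
    rw [Set.indicator_of_mem (Set.mem_Ioi.2 hn)]

lemma integral_tilt_limit {c₁ c₂ P₁ P₂ : ℝ} (hκ : 0 < c₁ * P₁ ^ 2 + c₂ * P₂ ^ 2) (ξ η : ℝ) :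
    (∫ u : ℝ,
        Complex.exp (c₁ * (P₁ * (1 - P₁) * (u + ξ * Complex.I) ^ 2 - P₁ * u ^ 2) / 2) *
        Complex.exp (c₂ * (P₂ * (1 - P₂) * (u + η * Complex.I) ^ 2 - P₂ * u ^ 2) / 2)) =
      (Real.pi / ((c₁ * P₁ ^ 2 + c₂ * P₂ ^ 2) / 2 : ℝ) : ℂ) ^ (1 / 2 : ℂ) *
      Complex.exp (-((c₁ * P₁ * (1 - P₁) * ξ ^ 2 + c₂ * P₂ * (1 - P₂) * η ^ 2 +
        (c₁ * P₁ * (1 - P₁) * ξ + c₂ * P₂ * (1 - P₂) * η) ^ 2 /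
          (c₁ * P₁ ^ 2 + c₂ * P₂ ^ 2)) / 2 : ℝ)) := by
  set κ := c₁ * P₁ ^ 2 + c₂ * P₂ ^ 2 with hκd
  have hb : (((-(κ / 2) : ℝ)) : ℂ).re < 0 := by rw [Complex.ofReal_re]; linarith
  have h := integral_cexp_quadratic hb
    (Complex.I * (c₁ * P₁ * (1 - P₁) * ξ + c₂ * P₂ * (1 - P₂) * η))
    (-(c₁ * P₁ * (1 - P₁) * ξ ^ 2 + c₂ * P₂ * (1 - P₂) * η ^ 2) / 2)
  have hκ' : (κ : ℂ) ≠ 0 := by exact_mod_cast hκ.ne'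
  convert h using 1
  · congr 1
    ext u
    rw [← Complex.exp_add]
    congr 1
    rw [hκd]
    push_cast
    ring_nf
    rw [Complex.I_sq]
    ring
  · congr 1
    · push_cast; ring_nf
    · congr 1
      rw [mul_pow, Complex.I_sq]
      push_cast
      field_simp
      ring

/-- The generating polynomial `∑ C(N₁,i) C(N₂,j) (i+j)! z₁^i z₂^j`. -/
noncomputable def mixSum (N₁ N₂ : ℕ) (z₁ z₂ : ℂ) : ℂ :=
  ∑ i ∈ Finset.range (N₁ + 1), ∑ j ∈ Finset.range (N₂ + 1),
    (N₁.choose i : ℂ) * (N₂.choose j : ℂ) * ((i + j).factorial : ℂ) * z₁ ^ i * z₂ ^ j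

lemma integral_exp_neg_mul_pow (m : ℕ) :
    Integrable (fun t : ℝ => Set.indicator (Set.Ioi 0)
      (fun t : ℝ => (Real.exp (-t) * t ^ m : ℂ)) t) ∧
    ∫ t : ℝ, Set.indicator (Set.Ioi 0) (fun t : ℝ => (Real.exp (-t) * t ^ m : ℂ)) t
      = m.factorial := by
  have hm : (0 : ℝ) < m + 1 := by positivity
  have h1 := Real.GammaIntegral_convergent hm
  have h2 := Real.Gamma_eq_integral hm
  rw [Real.Gamma_nat_eq_factorial] at h2
  simp only [add_sub_cancel_right, Real.rpow_natCast] at h1 h2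
  have hf : (fun t : ℝ => (Real.exp (-t) * t ^ m : ℂ))
      = fun t : ℝ => ((Real.exp (-t) * t ^ m : ℝ) : ℂ) := by
    ext t; push_cast; rfl
  refine ⟨?_, ?_⟩
  · rw [integrable_indicator_iff measurableSet_Ioi, hf]
    exact h1.ofReal
  · rw [integral_indicator measurableSet_Ioi, hf, integral_complex_ofReal, ← h2]
    simp

lemma mixSum_eq_integral (N₁ N₂ : ℕ) (z₁ z₂ : ℂ) :
    mixSum N₁ N₂ z₁ z₂ = ∫ t : ℝ, Set.indicator (Set.Ioi 0) (fun t : ℝ =>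
      (Real.exp (-t) * ((1 + z₁ * t) ^ N₁ * (1 + z₂ * t) ^ N₂) : ℂ)) t := by
  have hexp : ∀ t : ℝ, Set.indicator (Set.Ioi 0) (fun t : ℝ =>
      (Real.exp (-t) * ((1 + z₁ * t) ^ N₁ * (1 + z₂ * t) ^ N₂) : ℂ)) t =
      ∑ i ∈ Finset.range (N₁ + 1), ∑ j ∈ Finset.range (N₂ + 1),
        ((N₁.choose i : ℂ) * (N₂.choose j : ℂ) * z₁ ^ i * z₂ ^ j) *
          Set.indicator (Set.Ioi 0) (fun t : ℝ => (Real.exp (-t) * t ^ (i + j) : ℂ)) t := by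
    intro t
    by_cases ht : t ∈ Set.Ioi (0 : ℝ)
    · simp only [Set.indicator_of_mem ht]
      rw [add_comm 1 (z₁ * (t : ℂ)), add_comm 1 (z₂ * (t : ℂ)), add_pow, add_pow,
        Finset.sum_mul_sum, Finset.mul_sum]
      refine Finset.sum_congr rfl fun i _ => ?_
      rw [Finset.mul_sum]
      refine Finset.sum_congr rfl fun j _ => ?_
      simp only [one_pow, mul_one, mul_pow]
      ring
    · simp [Set.indicator_of_notMem ht]
  simp only [hexp]
  rw [integral_finsetSum]
  · unfold mixSum
    refine Finset.sum_congr rfl fun i _ => ?_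
    rw [integral_finsetSum]
    · refine Finset.sum_congr rfl fun j _ => ?_
      rw [integral_const_mul, (integral_exp_neg_mul_pow _).2]
      ring
    · exact fun j _ => (integral_exp_neg_mul_pow _).1.const_mul _
  · exact fun i _ => integrable_finsetSum _ fun j _ =>
      (integral_exp_neg_mul_pow _).1.const_mul _

/-- Saddle-point normalisation of the mixing integral. -/
lemma mixSum_eq_mul_integral_tiltIntegrand {N₁ N₂ j₁ j₂ n : ℕ} {a b t₀ p₁ p₂ : ℝ} (hn : 0 < n)
    (ht₀ : 0 < t₀) (hp₁ : p₁ * (1 + a * t₀) = a * t₀) (hp₂ : p₂ * (1 + b * t₀) = b * t₀)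
    (hbal : t₀ = (N₁ + j₁) * p₁ + (N₂ + j₂) * p₂) (ξ η : ℝ) :
    Complex.exp (-((Real.sqrt n)⁻¹ * (ξ * ((N₁ + j₁) * p₁ - j₁) + η * ((N₂ + j₂) * p₂ - j₂)) : ℝ)
        * Complex.I) *
      mixSum N₁ N₂ (a * Complex.exp ((Real.sqrt n)⁻¹ * ξ * Complex.I))
        (b * Complex.exp ((Real.sqrt n)⁻¹ * η * Complex.I)) =
      ((t₀ * (Real.sqrt n)⁻¹ * (Real.exp (-t₀) * (1 + a * t₀) ^ N₁ * (1 + b * t₀) ^ N₂) : ℝ) : ℂ) *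
        ∫ u, tiltIntegrand N₁ N₂ j₁ j₂ p₁ p₂ n ξ η u := by
  have hs : 0 < Real.sqrt n := by positivity
  set ε := (Real.sqrt n)⁻¹ with hε
  have hε0 : 0 < ε := by positivity
  have hεs : ε * Real.sqrt n = 1 := inv_mul_cancel₀ hs.ne'
  rw [mixSum_eq_integral]
  set f : ℝ → ℂ := fun t : ℝ => Set.indicator (Set.Ioi 0) (fun t : ℝ =>
      (Real.exp (-t) * ((1 + a * Complex.exp (ε * ξ * Complex.I) * t) ^ N₁ *
        (1 + b * Complex.exp (ε * η * Complex.I) * t) ^ N₂) : ℂ)) t with hf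
  have hcov : ∫ t, f t = (t₀ * ε : ℝ) * ∫ u, f (t₀ * ε * (u + Real.sqrt n)) := by
    rw [integral_add_right_eq_self (fun u => f (t₀ * ε * u)), Measure.integral_comp_mul_left,
      abs_of_pos (by positivity), Complex.real_smul, ← mul_assoc]
    rw [← Complex.ofReal_mul, mul_inv_cancel₀ (by positivity)]
    simp
  rw [hcov, ← integral_const_mul, ← integral_const_mul, ← integral_const_mul]
  congr 1
  ext u
  have hiff : t₀ * ε * (u + Real.sqrt n) ∈ Set.Ioi (0 : ℝ) ↔ u ∈ Set.Ioi (-Real.sqrt n) := by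
    rw [Set.mem_Ioi, Set.mem_Ioi, mul_pos_iff_of_pos_left (by positivity)]
    constructor <;> intro h <;> linarith
  by_cases hu : u ∈ Set.Ioi (-Real.sqrt n)
  · simp only [hf, tiltIntegrand]
    rw [Set.indicator_of_mem (hiff.2 hu), Set.indicator_of_mem hu]
    have ht : t₀ * ε * (u + Real.sqrt n) = t₀ * (1 + ε * u) := by
      rw [mul_add, mul_assoc t₀ ε (Real.sqrt n), hεs]; ring
    rw [ht]
    have hfac : ∀ (c p x : ℝ), p * (1 + c * t₀) = c * t₀ →
        (1 + c * Complex.exp (ε * x * Complex.I) * (t₀ * (1 + ε * u) : ℝ) : ℂ) =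
        (1 + c * t₀ : ℝ) * (1 + p * ((1 + ε * u) * Complex.exp (ε * x * Complex.I) - 1)) := by
      intro c p x hpc
      have hpc' : (p : ℂ) * (1 + c * t₀) = c * t₀ := by exact_mod_cast hpc
      push_cast
      linear_combination (-((1 + ε * u) * Complex.exp (ε * x * Complex.I) - 1)) * hpc'
    rw [hfac a p₁ ξ hp₁, hfac b p₂ η hp₂]
    simp only [tiltFactor, mul_pow]
    rw [← hε]
    generalize hA : (1 + p₁ * ((1 + ε * u) * Complex.exp (ε * ξ * Complex.I) - 1) : ℂ) ^ N₁ = A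
    generalize hB : (1 + p₂ * ((1 + ε * u) * Complex.exp (ε * η * Complex.I) - 1) : ℂ) ^ N₂ = B
    have hexp : Complex.exp (-(ε * (ξ * ((N₁ + j₁) * p₁ - j₁) + η * ((N₂ + j₂) * p₂ - j₂)) : ℝ)
        * Complex.I) * (Real.exp (-(t₀ * (1 + ε * u))) : ℂ) =
        (Real.exp (-t₀) : ℂ) * Complex.exp (-((N₁ + j₁) * p₁ * ε * (u + ξ * Complex.I))) *
        Complex.exp (ε * ξ * j₁ * Complex.I) *
        Complex.exp (-((N₂ + j₂) * p₂ * ε * (u + η * Complex.I))) *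
        Complex.exp (ε * η * j₂ * Complex.I) := by
      rw [Complex.ofReal_exp, Complex.ofReal_exp, ← Complex.exp_add, ← Complex.exp_add,
        ← Complex.exp_add, ← Complex.exp_add, ← Complex.exp_add]
      congr 1
      have hbal' : (t₀ : ℂ) = (N₁ + j₁) * p₁ + (N₂ + j₂) * p₂ := by exact_mod_cast hbal
      push_cast
      linear_combination (-(ε * u : ℂ)) * hbal'
    push_cast at hexp ⊢
    linear_combination (t₀ * ε * (1 + a * t₀) ^ N₁ * (1 + b * t₀) ^ N₂ * A * B) * hexp
  · simp only [hf, tiltIntegrand]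
    rw [Set.indicator_of_notMem (fun h => hu (hiff.1 h)), Set.indicator_of_notMem hu]
    simp

/-- The centred bivariate normal law of `(X, sX + Z)` with independent `X ~ N(0, v)`,
`Z ~ N(0, w)`. -/
noncomputable def bivariateGaussian (v w : NNReal) (s : ℝ) : Measure (WithLp 2 (ℝ × ℝ)) :=
  ((ProbabilityTheory.gaussianReal 0 v).prod (ProbabilityTheory.gaussianReal 0 w)).map
    (fun q => WithLp.toLp 2 (q.1, s * q.1 + q.2))

lemma continuous_shear (s : ℝ) :
    Continuous (fun q : ℝ × ℝ => WithLp.toLp 2 (q.1, s * q.1 + q.2)) :=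
  (WithLp.prod_continuous_toLp 2 ℝ ℝ).comp (by fun_prop)

instance (v w : NNReal) (s : ℝ) : IsProbabilityMeasure (bivariateGaussian v w s) :=
  Measure.isProbabilityMeasure_map (continuous_shear s).measurable.aemeasurable

lemma charFun_bivariateGaussian (v w : NNReal) (s ξ η : ℝ) :
    charFun (bivariateGaussian v w s) (WithLp.toLp 2 (ξ, η)) =
      Complex.exp (-((v * (ξ + s * η) ^ 2 + w * η ^ 2) / 2 : ℝ)) := by
  rw [charFun_apply, bivariateGaussian, integral_map (continuous_shear s).measurable.aemeasurable
    (by fun_prop)]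
  have h : ∀ q : ℝ × ℝ, Complex.exp ((inner ℝ (WithLp.toLp 2 (q.1, s * q.1 + q.2))
      (WithLp.toLp 2 (ξ, η)) : ℝ) * Complex.I) =
      Complex.exp ((inner ℝ q.1 (ξ + s * η) : ℝ) * Complex.I) *
        Complex.exp ((inner ℝ q.2 η : ℝ) * Complex.I) := by
    intro q
    rw [← Complex.exp_add]
    congr 1
    simp only [WithLp.prod_inner_apply, RCLike.inner_apply, conj_trivial]
    push_cast
    ring
  simp only [h]
  rw [integral_prod_mul (fun x : ℝ => Complex.exp ((inner ℝ x (ξ + s * η) : ℝ) * Complex.I))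
    (fun x : ℝ => Complex.exp ((inner ℝ x η : ℝ) * Complex.I)), ← charFun_apply, ← charFun_apply,
    ProbabilityTheory.charFun_gaussianReal, ProbabilityTheory.charFun_gaussianReal,
    ← Complex.exp_add]
  congr 1
  push_cast
  ring

/-- The closed lower-left quadrant with corner `(a, b)`. -/
def lowerQuadrant (a b : ℝ) : Set (WithLp 2 (ℝ × ℝ)) := {x | x.fst ≤ a} ∩ {x | x.snd ≤ b}

lemma isClosed_lowerQuadrant (a b : ℝ) : IsClosed (lowerQuadrant a b) :=
  (isClosed_le (f := fun x : WithLp 2 (ℝ × ℝ) => x.fst) (by fun_prop) continuous_const).inter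
    (isClosed_le (f := fun x : WithLp 2 (ℝ × ℝ) => x.snd) (by fun_prop) continuous_const)

lemma frontier_lowerQuadrant_subset (a b : ℝ) :
    frontier (lowerQuadrant a b) ⊆ {x | x.fst = a} ∪ {x | x.snd = b} := by
  intro x hx
  rw [(isClosed_lowerQuadrant a b).frontier_eq] at hx
  by_contra hne
  simp only [Set.mem_union, Set.mem_ofPred_eq, not_or] at hne
  apply hx.2
  have hopen : IsOpen ({x : WithLp 2 (ℝ × ℝ) | x.fst < a} ∩ {x | x.snd < b}) :=
    (isOpen_lt (f := fun x : WithLp 2 (ℝ × ℝ) => x.fst) (by fun_prop) continuous_const).inter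
      (isOpen_lt (f := fun x : WithLp 2 (ℝ × ℝ) => x.snd) (by fun_prop) continuous_const)
  have hsub : ({x : WithLp 2 (ℝ × ℝ) | x.fst < a} ∩ {x | x.snd < b}) ⊆ lowerQuadrant a b :=
    fun y hy => ⟨(show y.fst < a from hy.1).le, (show y.snd < b from hy.2).le⟩
  exact interior_maximal hsub hopen ⟨lt_of_le_of_ne hx.1.1 hne.1, lt_of_le_of_ne hx.1.2 hne.2⟩

lemma bivariateGaussian_frontier_lowerQuadrant {v w : NNReal} (hv : v ≠ 0) (hw : w ≠ 0)
    (s a b : ℝ) : bivariateGaussian v w s (frontier (lowerQuadrant a b)) = 0 := by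
  have := ProbabilityTheory.nullSingletonClass_gaussianReal (μ := 0) hv
  have := ProbabilityTheory.nullSingletonClass_gaussianReal (μ := 0) hw
  refine measure_mono_null (frontier_lowerQuadrant_subset a b) (measure_union_null ?_ ?_)
  · have hm : MeasurableSet {x : WithLp 2 (ℝ × ℝ) | x.fst = a} :=
      (isClosed_eq (by fun_prop) continuous_const).measurableSet
    rw [bivariateGaussian, Measure.map_apply (continuous_shear s).measurable hm]
    have : (fun q : ℝ × ℝ => WithLp.toLp 2 (q.1, s * q.1 + q.2)) ⁻¹'
        {x : WithLp 2 (ℝ × ℝ) | x.fst = a} = {a} ×ˢ Set.univ := by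
      ext q; simp
    rw [this, Measure.prod_prod]
    simp
  · have hm : MeasurableSet {x : WithLp 2 (ℝ × ℝ) | x.snd = b} :=
      (isClosed_eq (by fun_prop) continuous_const).measurableSet
    rw [bivariateGaussian, Measure.map_apply (continuous_shear s).measurable hm,
      Measure.prod_apply ((continuous_shear s).measurable hm)]
    refine (lintegral_congr fun x => ?_).trans lintegral_zero
    have : Prod.mk x ⁻¹' ((fun q : ℝ × ℝ => WithLp.toLp 2 (q.1, s * q.1 + q.2)) ⁻¹'
        {x : WithLp 2 (ℝ × ℝ) | x.snd = b}) = {b - s * x} := by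
      ext z
      simp only [Set.mem_preimage, Set.mem_ofPred_eq, Set.mem_singleton_iff,
        WithLp.toLp_snd]
      constructor <;> intro h <;> linarith
    rw [this]
    simp

lemma bivariateGaussian_real_lowerQuadrant {v w : NNReal} (hv : v ≠ 0) (hw : w ≠ 0)
    (s a b : ℝ) : (bivariateGaussian v w s).real (lowerQuadrant a b) =
      ∫ x in Set.Iic a, ∫ y in Set.Iic b, ProbabilityTheory.gaussianPDFReal 0 v x *
        ProbabilityTheory.gaussianPDFReal 0 w (y - s * x) := by
  set γ := ProbabilityTheory.gaussianReal 0 v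
  set γ' := ProbabilityTheory.gaussianReal 0 w
  have hm : MeasurableSet ((fun q : ℝ × ℝ => WithLp.toLp 2 (q.1, s * q.1 + q.2)) ⁻¹'
      lowerQuadrant a b) :=
    (continuous_shear s).measurable (isClosed_lowerQuadrant a b).measurableSet
  have hslice : ∀ x : ℝ, γ'.real (Prod.mk x ⁻¹' ((fun q : ℝ × ℝ =>
      WithLp.toLp 2 (q.1, s * q.1 + q.2)) ⁻¹' lowerQuadrant a b)) =
      Set.indicator (Set.Iic a) (fun x => ∫ y in Set.Iic b,
        ProbabilityTheory.gaussianPDFReal 0 w (y - s * x)) x := by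
    intro x
    by_cases hx : x ≤ a
    · rw [Set.indicator_of_mem (Set.mem_Iic.2 hx)]
      have : Prod.mk x ⁻¹' ((fun q : ℝ × ℝ => WithLp.toLp 2 (q.1, s * q.1 + q.2)) ⁻¹'
          lowerQuadrant a b) = Set.Iic (b - s * x) := by
        ext z
        simp only [lowerQuadrant, Set.mem_preimage, Set.mem_inter_iff, Set.mem_ofPred_eq,
          Set.mem_Iic, WithLp.toLp_fst, WithLp.toLp_snd, hx, true_and]
        constructor <;> intro h <;> linarith
      rw [this, measureReal_def, ProbabilityTheory.gaussianReal_apply_eq_integral 0 hw,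
        ENNReal.toReal_ofReal (integral_nonneg fun z =>
          ProbabilityTheory.gaussianPDFReal_nonneg _ _ _),
        ← integral_indicator measurableSet_Iic, ← integral_indicator measurableSet_Iic,
        ← integral_sub_right_eq_self _ (s * x)]
      congr 1
      ext y
      simp only [Set.indicator_apply, Set.mem_Iic, sub_le_sub_iff_right]
    · rw [Set.indicator_of_notMem (by simpa using hx)]
      have : Prod.mk x ⁻¹' ((fun q : ℝ × ℝ => WithLp.toLp 2 (q.1, s * q.1 + q.2)) ⁻¹'
          lowerQuadrant a b) = ∅ := by
        ext z
        simp [lowerQuadrant, hx]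
      simp [this]
  rw [bivariateGaussian, measureReal_def,
    Measure.map_apply (continuous_shear s).measurable (isClosed_lowerQuadrant a b).measurableSet,
    Measure.prod_apply hm, ← integral_toReal (measurable_measure_prodMk_left hm).aemeasurable
      (Eventually.of_forall fun x => measure_lt_top _ _)]
  have h2 : ∀ x : ℝ, (γ' (Prod.mk x ⁻¹' ((fun q : ℝ × ℝ =>
      WithLp.toLp 2 (q.1, s * q.1 + q.2)) ⁻¹' lowerQuadrant a b))).toReal = _ := hslice
  rw [integral_congr_ae (Eventually.of_forall h2)]
  rw [ProbabilityTheory.integral_gaussianReal_eq_integral_smul hv,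
    ← integral_indicator measurableSet_Iic]
  congr 1
  ext x
  by_cases hx : x ∈ Set.Iic a
  · simp only [Set.indicator_of_mem hx, smul_eq_mul]
    rw [integral_const_mul]
  · simp [Set.indicator_of_notMem hx]

/-- The normalised finite sum of point masses `w i` at `X i`. -/
noncomputable def weightedDirac {ι E : Type*} [MeasurableSpace E] (S : Finset ι) (w : ι → ℝ)
    (X : ι → E) : Measure E :=
  ∑ i ∈ S, ENNReal.ofReal (w i / ∑ i ∈ S, w i) • Measure.dirac (X i)

section weightedDirac

variable {ι E : Type*} [MeasurableSpace E] {S : Finset ι} {w : ι → ℝ} {X : ι → E}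

lemma isProbabilityMeasure_weightedDirac (hw : ∀ i ∈ S, 0 ≤ w i) (hS : 0 < ∑ i ∈ S, w i) :
    IsProbabilityMeasure (weightedDirac S w X) := by
  constructor
  simp only [weightedDirac, Measure.coe_finsetSum, Finset.sum_apply, Measure.smul_apply,
    measure_univ, smul_eq_mul, mul_one]
  rw [← ENNReal.ofReal_sum_of_nonneg (fun i hi => div_nonneg (hw i hi) hS.le),
    ← Finset.sum_div, div_self hS.ne', ENNReal.ofReal_one]

lemma integral_weightedDirac [MeasurableSingletonClass E] (hw : ∀ i ∈ S, 0 ≤ w i)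
    (hS : 0 < ∑ i ∈ S, w i) (f : E → ℂ) :
    ∫ x, f x ∂(weightedDirac S w X) = (∑ i ∈ S, w i * f (X i)) / (∑ i ∈ S, w i : ℝ) := by
  rw [weightedDirac, integral_finsetSum_measure, Finset.sum_div]
  · refine Finset.sum_congr rfl fun i hi => ?_
    rw [integral_smul_measure, integral_dirac, ENNReal.toReal_ofReal (div_nonneg (hw i hi) hS.le),
      Complex.real_smul]
    push_cast
    ring
  · exact fun i _ => (integrable_dirac (by simp)).smul_measure ENNReal.ofReal_ne_top

lemma weightedDirac_real [MeasurableSingletonClass E] (hw : ∀ i ∈ S, 0 ≤ w i)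
    (hS : 0 < ∑ i ∈ S, w i) (A : Set E) [DecidablePred (· ∈ A)] :
    (weightedDirac S w X).real A =
      (∑ i ∈ S, if X i ∈ A then w i else 0) / ∑ i ∈ S, w i := by
  simp only [measureReal_def, weightedDirac, Measure.coe_finsetSum, Finset.sum_apply,
    Measure.smul_apply, smul_eq_mul]
  rw [ENNReal.toReal_sum, Finset.sum_div]
  · refine Finset.sum_congr rfl fun i hi => ?_
    rw [ENNReal.toReal_mul, ENNReal.toReal_ofReal (div_nonneg (hw i hi) hS.le),
      Measure.dirac_apply, Set.indicator_apply]
    split_ifs <;> simp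
  · exact fun i _ => ENNReal.mul_ne_top ENNReal.ofReal_ne_top (measure_ne_top _ _)

end weightedDirac

/-- Weight of `(i, j)` in the Poisson-type mixture of two binomial counts. -/
noncomputable def mixWeight (N₁ N₂ : ℕ) (a b : ℝ) (q : ℕ × ℕ) : ℝ :=
  (N₁.choose q.1 : ℝ) * (N₂.choose q.2 : ℝ) * ((q.1 + q.2).factorial : ℝ) * a ^ q.1 * b ^ q.2

/-- The index box carrying the mixture weights. -/
def mixBox (N₁ N₂ : ℕ) : Finset (ℕ × ℕ) := Finset.range (N₁ + 1) ×ˢ Finset.range (N₂ + 1)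

lemma mixWeight_nonneg {N₁ N₂ : ℕ} {a b : ℝ} (ha : 0 ≤ a) (hb : 0 ≤ b) (q : ℕ × ℕ) :
    0 ≤ mixWeight N₁ N₂ a b q := by
  unfold mixWeight; positivity

lemma sum_mixWeight_pos {N₁ N₂ : ℕ} {a b : ℝ} (ha : 0 ≤ a) (hb : 0 ≤ b) :
    0 < ∑ q ∈ mixBox N₁ N₂, mixWeight N₁ N₂ a b q := by
  refine Finset.sum_pos' (fun q _ => mixWeight_nonneg ha hb q) ⟨(0, 0), ?_, ?_⟩
  · simp [mixBox]
  · simp [mixWeight]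

lemma sum_mixWeight_mul (N₁ N₂ : ℕ) (a b : ℝ) (z₁ z₂ : ℂ) :
    ∑ q ∈ mixBox N₁ N₂, (mixWeight N₁ N₂ a b q : ℂ) * (z₁ ^ q.1 * z₂ ^ q.2) =
      mixSum N₁ N₂ (a * z₁) (b * z₂) := by
  rw [mixBox, mixSum, Finset.sum_product]
  refine Finset.sum_congr rfl fun i _ => Finset.sum_congr rfl fun j _ => ?_
  simp only [mixWeight, mul_pow]
  push_cast
  ring

lemma sum_mixWeight (N₁ N₂ : ℕ) (a b : ℝ) :
    ((∑ q ∈ mixBox N₁ N₂, mixWeight N₁ N₂ a b q : ℝ) : ℂ) = mixSum N₁ N₂ a b := by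
  have := sum_mixWeight_mul N₁ N₂ a b 1 1
  simpa using this

/-- The asymptotic regime in which the mixture of binomials concentrates at a saddle point. -/
structure TiltRegime (N₁ N₂ : ℕ → ℕ) (j₁ j₂ : ℕ) (a b t₀ p₁ p₂ : ℕ → ℝ) (c₁ c₂ P₁ P₂ : ℝ) :
    Prop where
  a_nonneg : ∀ n, 0 ≤ a n
  b_nonneg : ∀ n, 0 ≤ b n
  c₁_pos : 0 < c₁
  c₂_pos : 0 < c₂
  P₁_mem : P₁ ∈ Set.Ioo (0 : ℝ) 1
  P₂_mem : P₂ ∈ Set.Ioo (0 : ℝ) 1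
  N₁_lim : Tendsto (fun n => (N₁ n : ℝ) / n) atTop (nhds c₁)
  N₂_lim : Tendsto (fun n => (N₂ n : ℝ) / n) atTop (nhds c₂)
  p₁_lim : Tendsto p₁ atTop (nhds P₁)
  p₂_lim : Tendsto p₂ atTop (nhds P₂)
  saddle : ∀ᶠ n in atTop, 0 < t₀ n ∧ p₁ n * (1 + a n * t₀ n) = a n * t₀ n ∧
    p₂ n * (1 + b n * t₀ n) = b n * t₀ n ∧ t₀ n = (N₁ n + j₁) * p₁ n + (N₂ n + j₂) * p₂ n

namespace TiltRegime

variable {N₁ N₂ : ℕ → ℕ} {j₁ j₂ : ℕ} {a b t₀ p₁ p₂ : ℕ → ℝ} {c₁ c₂ P₁ P₂ : ℝ}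

/-- The rescaled, centred position of the point `q`. -/
noncomputable def position (N₁ N₂ : ℕ → ℕ) (j₁ j₂ : ℕ) (p₁ p₂ : ℕ → ℝ) (n : ℕ) (q : ℕ × ℕ) :
    WithLp 2 (ℝ × ℝ) :=
  WithLp.toLp 2 ((Real.sqrt n)⁻¹ * (q.1 + j₁ - (N₁ n + j₁) * p₁ n),
    (Real.sqrt n)⁻¹ * (q.2 + j₂ - (N₂ n + j₂) * p₂ n))

/-- The rescaled law of the mixture. -/
noncomputable def law (N₁ N₂ : ℕ → ℕ) (j₁ j₂ : ℕ) (a b p₁ p₂ : ℕ → ℝ) (n : ℕ) :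
    Measure (WithLp 2 (ℝ × ℝ)) :=
  weightedDirac (mixBox (N₁ n) (N₂ n)) (mixWeight (N₁ n) (N₂ n) (a n) (b n))
    (position N₁ N₂ j₁ j₂ p₁ p₂ n)

lemma κ_pos (h : TiltRegime N₁ N₂ j₁ j₂ a b t₀ p₁ p₂ c₁ c₂ P₁ P₂) :
    0 < c₁ * P₁ ^ 2 + c₂ * P₂ ^ 2 := by
  have := h.c₁_pos
  have := h.c₂_pos
  have := h.P₁_mem.1
  positivity

lemma tendsto_integral (h : TiltRegime N₁ N₂ j₁ j₂ a b t₀ p₁ p₂ c₁ c₂ P₁ P₂) (ξ η : ℝ) :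
    Tendsto (fun n => ∫ u, tiltIntegrand (N₁ n) (N₂ n) j₁ j₂ (p₁ n) (p₂ n) n ξ η u) atTop
      (nhds ((Real.pi / ((c₁ * P₁ ^ 2 + c₂ * P₂ ^ 2) / 2 : ℝ) : ℂ) ^ (1 / 2 : ℂ) *
      Complex.exp (-((c₁ * P₁ * (1 - P₁) * ξ ^ 2 + c₂ * P₂ * (1 - P₂) * η ^ 2 +
        (c₁ * P₁ * (1 - P₁) * ξ + c₂ * P₂ * (1 - P₂) * η) ^ 2 /
          (c₁ * P₁ ^ 2 + c₂ * P₂ ^ 2)) / 2 : ℝ)))) := by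
  rw [← integral_tilt_limit h.κ_pos]
  exact tendsto_integral_tiltIntegrand j₁ j₂ h.c₁_pos h.P₁_mem h.P₂_mem h.N₁_lim h.N₂_lim
    h.p₁_lim h.p₂_lim ξ η

lemma prefactor_ne_zero (h : TiltRegime N₁ N₂ j₁ j₂ a b t₀ p₁ p₂ c₁ c₂ P₁ P₂) :
    (Real.pi / ((c₁ * P₁ ^ 2 + c₂ * P₂ ^ 2) / 2 : ℝ) : ℂ) ^ (1 / 2 : ℂ) ≠ 0 := by
  have hκ := h.κ_pos
  rw [Ne, Complex.cpow_eq_zero_iff, not_and_or]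
  left
  rw [← Complex.ofReal_div]
  exact_mod_cast (div_pos Real.pi_pos (half_pos hκ)).ne'

lemma tendsto_charFun (h : TiltRegime N₁ N₂ j₁ j₂ a b t₀ p₁ p₂ c₁ c₂ P₁ P₂) (ξ η : ℝ) :
    Tendsto (fun n => charFun (law N₁ N₂ j₁ j₂ a b p₁ p₂ n) (WithLp.toLp 2 (ξ, η))) atTop
      (nhds (Complex.exp (-((c₁ * P₁ * (1 - P₁) * ξ ^ 2 + c₂ * P₂ * (1 - P₂) * η ^ 2 +
        (c₁ * P₁ * (1 - P₁) * ξ + c₂ * P₂ * (1 - P₂) * η) ^ 2 /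
          (c₁ * P₁ ^ 2 + c₂ * P₂ ^ 2)) / 2 : ℝ)))) := by
  have h0 := h.tendsto_integral 0 0
  have hne := h.prefactor_ne_zero
  have hlim := (h.tendsto_integral ξ η).div h0 (mul_ne_zero hne (Complex.exp_ne_zero _))
  have hval : ∀ z : ℂ, (Real.pi / ((c₁ * P₁ ^ 2 + c₂ * P₂ ^ 2) / 2 : ℝ) : ℂ) ^ (1 / 2 : ℂ) * z /
      ((Real.pi / ((c₁ * P₁ ^ 2 + c₂ * P₂ ^ 2) / 2 : ℝ) : ℂ) ^ (1 / 2 : ℂ) *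
      Complex.exp (-((c₁ * P₁ * (1 - P₁) * 0 ^ 2 + c₂ * P₂ * (1 - P₂) * 0 ^ 2 +
        (c₁ * P₁ * (1 - P₁) * 0 + c₂ * P₂ * (1 - P₂) * 0) ^ 2 /
          (c₁ * P₁ ^ 2 + c₂ * P₂ ^ 2)) / 2 : ℝ))) = z := by
    intro z
    simp only [ne_eq, OfNat.ofNat_ne_zero, not_false_eq_true, zero_pow, mul_zero, add_zero,
      zero_div, neg_zero, Complex.ofReal_zero, Complex.exp_zero, mul_one]
    exact mul_div_cancel_left₀ z hne
  rw [hval] at hlim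
  refine hlim.congr' ?_
  filter_upwards [h.saddle, eventually_gt_atTop 0] with n ⟨ht₀, hp₁, hp₂, hbal⟩ hn
  have ha := h.a_nonneg n
  have hb := h.b_nonneg n
  have key := mixSum_eq_mul_integral_tiltIntegrand hn ht₀ hp₁ hp₂ hbal
  have hK : (0 : ℝ) < t₀ n * (Real.sqrt n)⁻¹ *
      (Real.exp (-t₀ n) * (1 + a n * t₀ n) ^ N₁ n * (1 + b n * t₀ n) ^ N₂ n) := by
    positivity
  have hK' : ((t₀ n * (Real.sqrt n)⁻¹ * (Real.exp (-t₀ n) * (1 + a n * t₀ n) ^ N₁ n *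
      (1 + b n * t₀ n) ^ N₂ n) : ℝ) : ℂ) ≠ 0 := by exact_mod_cast hK.ne'
  have key0 := key 0 0
  simp only [zero_mul, add_zero, mul_zero, neg_zero, Complex.ofReal_zero, Complex.exp_zero,
    one_mul, mul_one] at key0
  rw [law, charFun_apply, integral_weightedDirac (fun q _ => mixWeight_nonneg ha hb q)
    (sum_mixWeight_pos ha hb), sum_mixWeight, key0]
  rw [Pi.div_apply, ← mul_div_mul_left _ _ hK', ← key ξ η, ← sum_mixWeight_mul, Finset.mul_sum]
  congr 1
  refine Finset.sum_congr rfl fun q _ => ?_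
  rw [mul_left_comm, ← Complex.exp_nat_mul, ← Complex.exp_nat_mul, ← Complex.exp_add,
    ← Complex.exp_add]
  congr 2
  simp only [position, WithLp.prod_inner_apply, RCLike.inner_apply, conj_trivial]
  push_cast
  ring

lemma tendsto_law_lowerQuadrant (h : TiltRegime N₁ N₂ j₁ j₂ a b t₀ p₁ p₂ c₁ c₂ P₁ P₂)
    {v w : NNReal} {s : ℝ} (hv : v ≠ 0) (hw : w ≠ 0)
    (hvw : ∀ ξ η : ℝ, v * (ξ + s * η) ^ 2 + w * η ^ 2 =
      c₁ * P₁ * (1 - P₁) * ξ ^ 2 + c₂ * P₂ * (1 - P₂) * η ^ 2 +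
        (c₁ * P₁ * (1 - P₁) * ξ + c₂ * P₂ * (1 - P₂) * η) ^ 2 /
          (c₁ * P₁ ^ 2 + c₂ * P₂ ^ 2)) (x y : ℝ) :
    Tendsto (fun n => (law N₁ N₂ j₁ j₂ a b p₁ p₂ n).real (lowerQuadrant x y)) atTop
      (nhds ((bivariateGaussian v w s).real (lowerQuadrant x y))) := by
  let μ : ℕ → ProbabilityMeasure (WithLp 2 (ℝ × ℝ)) := fun n =>
    ⟨law N₁ N₂ j₁ j₂ a b p₁ p₂ n, isProbabilityMeasure_weightedDirac
      (fun q _ => mixWeight_nonneg (h.a_nonneg n) (h.b_nonneg n) q)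
      (sum_mixWeight_pos (h.a_nonneg n) (h.b_nonneg n))⟩
  let ν : ProbabilityMeasure (WithLp 2 (ℝ × ℝ)) := ⟨bivariateGaussian v w s, inferInstance⟩
  have hweak : Tendsto μ atTop (nhds ν) := by
    rw [ProbabilityMeasure.tendsto_iff_tendsto_charFun]
    intro t
    have ht : t = WithLp.toLp 2 (t.fst, t.snd) := rfl
    have := h.tendsto_charFun t.fst t.snd
    rw [← hvw, ← charFun_bivariateGaussian, ← ht] at this
    exact this
  have hm := ProbabilityMeasure.tendsto_measure_of_null_frontier_of_tendsto' hweak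
    (E := lowerQuadrant x y) (bivariateGaussian_frontier_lowerQuadrant hv hw s x y)
  exact (ENNReal.tendsto_toReal (measure_ne_top _ _)).comp hm

lemma tendsto_sum_mixWeight_atTop (h : TiltRegime N₁ N₂ j₁ j₂ a b t₀ p₁ p₂ c₁ c₂ P₁ P₂) :
    Tendsto (fun n => ∑ q ∈ mixBox (N₁ n) (N₂ n), mixWeight (N₁ n) (N₂ n) (a n) (b n) q)
      atTop atTop := by
  set C := Real.exp j₁ * Real.exp j₂ * Real.exp (c₁ / 2 * (P₁ / 2) ^ 2 / 4) with hC
  have hCpos : 0 < C := by positivity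
  have hs : Tendsto (fun n : ℕ => Real.sqrt n) atTop atTop :=
    Real.tendsto_sqrt_atTop.comp tendsto_natCast_atTop_atTop
  have hI := (h.tendsto_integral 0 0).norm
  have hlim : 0 < ‖(Real.pi / ((c₁ * P₁ ^ 2 + c₂ * P₂ ^ 2) / 2 : ℝ) : ℂ) ^ (1 / 2 : ℂ) *
      Complex.exp (-((c₁ * P₁ * (1 - P₁) * 0 ^ 2 + c₂ * P₂ * (1 - P₂) * 0 ^ 2 +
        (c₁ * P₁ * (1 - P₁) * 0 + c₂ * P₂ * (1 - P₂) * 0) ^ 2 /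
          (c₁ * P₁ ^ 2 + c₂ * P₂ ^ 2)) / 2 : ℝ))‖ :=
    norm_pos_iff.2 (mul_ne_zero h.prefactor_ne_zero (Complex.exp_ne_zero _))
  have hbase : Tendsto (fun n : ℕ => Real.sqrt n * (C⁻¹ * ((N₁ n : ℝ) / n * p₁ n) *
      ‖∫ u, tiltIntegrand (N₁ n) (N₂ n) j₁ j₂ (p₁ n) (p₂ n) n 0 0 u‖)) atTop atTop :=
    hs.atTop_mul_pos
      (mul_pos (mul_pos (inv_pos.2 hCpos) (mul_pos h.c₁_pos h.P₁_mem.1)) hlim)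
      (((h.N₁_lim.mul h.p₁_lim).const_mul _).mul hI)
  refine tendsto_atTop_mono' _ ?_ hbase
  filter_upwards [h.saddle, eventually_gt_atTop 0, h.p₁_lim.eventually_lt_const h.P₁_mem.2,
      h.p₁_lim.eventually_const_le (half_lt_self h.P₁_mem.1),
      h.N₁_lim.eventually_const_le (half_lt_self h.c₁_pos),
      h.p₂_lim.eventually_lt_const h.P₂_mem.2, h.p₂_lim.eventually_const_le h.P₂_mem.1]
    with n ⟨ht₀, hp₁, hp₂, hbal⟩ hn h1 h2 h3 h4 h5
  have ha := h.a_nonneg n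
  have hb := h.b_nonneg n
  have hP := h.P₁_mem.1
  have hn0 : (0 : ℝ) < n := by exact_mod_cast hn
  have hsn : 0 < Real.sqrt n := by positivity
  have key0 := mixSum_eq_mul_integral_tiltIntegrand hn ht₀ hp₁ hp₂ hbal 0 0
  simp only [zero_mul, add_zero, mul_zero, neg_zero, Complex.ofReal_zero, Complex.exp_zero,
    one_mul, mul_one] at key0
  rw [← sum_mixWeight] at key0
  have key1 := congrArg norm key0
  have hexp1 : (1 - p₁ n) * (1 + a n * t₀ n) = 1 := by linarith
  have hexp2 : (1 - p₂ n) * (1 + b n * t₀ n) = 1 := by linarith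
  set G := Real.exp (-t₀ n) * (1 + a n * t₀ n) ^ N₁ n * (1 + b n * t₀ n) ^ N₂ n with hG
  have hGpos : 0 < G := by positivity
  rw [norm_mul, Complex.norm_real, Complex.norm_real,
    Real.norm_of_nonneg (sum_mixWeight_pos ha hb).le, Real.norm_of_nonneg (by positivity)] at key1
  rw [key1]
  have hbound := norm_tiltFactor_mul_le (N₁ := N₁ n) (N₂ := N₂ n) (j₁ := j₁) (j₂ := j₂)
    (u := -Real.sqrt n) 0 0 hn h1.le (half_pos hP)
    (half_pos h.c₁_pos) h2 h3 h5 h4.le le_rfl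
  have hε : (Real.sqrt n)⁻¹ * Real.sqrt n = 1 := inv_mul_cancel₀ hsn.ne'
  have hεc : (((Real.sqrt n)⁻¹ : ℝ) : ℂ) * (Real.sqrt n : ℂ) = 1 := by exact_mod_cast hε
  have hfac : ∀ (N j : ℕ) (p : ℝ), tiltFactor N j p (Real.sqrt n)⁻¹ 0 (-Real.sqrt n) =
      ((Real.exp ((N + j) * p) * (1 - p) ^ N : ℝ) : ℂ) := by
    intro N j p
    unfold tiltFactor
    have e1 : (-((N + j) * p * ((Real.sqrt n)⁻¹ : ℝ) *
        ((-Real.sqrt n : ℝ) + (0 : ℝ) * Complex.I)) : ℂ) = (N + j) * p := by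
      push_cast
      push_cast at hεc
      linear_combination ((N + j) * p : ℂ) * hεc
    have e2 : (1 + (((Real.sqrt n)⁻¹ : ℝ) : ℂ) * ((-Real.sqrt n : ℝ) : ℂ)) = 0 := by
      push_cast
      push_cast at hεc
      linear_combination -hεc
    rw [e1, e2]
    push_cast
    simp [sub_eq_add_neg]
  have hGinv : ‖tiltFactor (N₁ n) j₁ (p₁ n) (Real.sqrt n)⁻¹ 0 (-Real.sqrt n) *
      tiltFactor (N₂ n) j₂ (p₂ n) (Real.sqrt n)⁻¹ 0 (-Real.sqrt n)‖ = G⁻¹ := by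
    rw [hfac, hfac, ← Complex.ofReal_mul, Complex.norm_real]
    have h1' : 0 < 1 - p₁ n := by linarith
    have h4' : 0 < 1 - p₂ n := by linarith
    rw [Real.norm_of_nonneg (by positivity)]
    refine eq_inv_of_mul_eq_one_left ?_
    rw [hG]
    have : Real.exp ((N₁ n + j₁) * p₁ n) * Real.exp ((N₂ n + j₂) * p₂ n) * Real.exp (-t₀ n)
        = 1 := by
      rw [← Real.exp_add, ← Real.exp_add, hbal]; simp
    calc _ = (Real.exp ((N₁ n + j₁) * p₁ n) * Real.exp ((N₂ n + j₂) * p₂ n) *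
          Real.exp (-t₀ n)) * ((1 - p₁ n) * (1 + a n * t₀ n)) ^ N₁ n *
          ((1 - p₂ n) * (1 + b n * t₀ n)) ^ N₂ n := by rw [mul_pow, mul_pow]; ring
      _ = 1 := by rw [this, hexp1, hexp2]; simp
  rw [hGinv] at hbound
  have hGC : C⁻¹ ≤ G := by
    rw [inv_le_comm₀ hCpos hGpos]
    refine hbound.trans ?_
    refine mul_le_of_le_one_right hCpos.le ?_
    rw [Real.exp_le_one_iff, neg_nonpos]
    have := h.c₁_pos
    positivity
  have ht : Real.sqrt n * ((N₁ n : ℝ) / n * p₁ n) ≤ t₀ n * (Real.sqrt n)⁻¹ := by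
    have hnn : (n : ℝ) = Real.sqrt n * Real.sqrt n := (Real.mul_self_sqrt hn0.le).symm
    have : Real.sqrt n * ((N₁ n : ℝ) / n * p₁ n) = N₁ n * p₁ n * (Real.sqrt n)⁻¹ := by
      nth_rewrite 2 [hnn]
      field_simp
    rw [this]
    gcongr
    rw [hbal]
    have : 0 ≤ p₁ n := le_trans (by positivity) h2
    have : 0 ≤ (j₁ : ℝ) * p₁ n := by positivity
    have : 0 ≤ (N₂ n + j₂) * p₂ n := by positivity
    linarith
  calc _ = (Real.sqrt n * ((N₁ n : ℝ) / n * p₁ n)) * C⁻¹ *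
        ‖∫ u, tiltIntegrand (N₁ n) (N₂ n) j₁ j₂ (p₁ n) (p₂ n) n 0 0 u‖ := by ring
    _ ≤ _ := by gcongr

end TiltRegime

section asymptotics

variable {μ₁ μ₂ θ ρ α : ℝ}

lemma Npool1_le {θ : ℝ} (hθ : θ ≤ 1) (n : ℕ) : Npool1 θ n ≤ n := by
  refine Nat.ceil_le.2 (mul_le_of_le_one_left n.cast_nonneg hθ)

lemma cast_Npool2 {θ : ℝ} (hθ : θ ≤ 1) (n : ℕ) : (Npool2 θ n : ℝ) = n - Npool1 θ n := by
  rw [Npool2, Nat.cast_sub (Npool1_le hθ n)]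

lemma tendsto_Npool1_div {θ : ℝ} (hθ : 0 ≤ θ) :
    Tendsto (fun n : ℕ => (Npool1 θ n : ℝ) / n) atTop (nhds θ) :=
  (tendsto_nat_ceil_mul_div_atTop hθ).comp tendsto_natCast_atTop_atTop

lemma tendsto_Npool2_div {θ : ℝ} (hθ : θ ∈ Set.Icc (0 : ℝ) 1) :
    Tendsto (fun n : ℕ => (Npool2 θ n : ℝ) / n) atTop (nhds (1 - θ)) := by
  refine ((tendsto_Npool1_div hθ.1).const_sub 1).congr' ?_
  filter_upwards [eventually_gt_atTop 0] with n hn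
  have : (n : ℝ) ≠ 0 := by positivity
  rw [cast_Npool2 hθ.2, sub_div, div_self this]

lemma tendsto_Nlam_div (μ₁ μ₂ : ℝ) (ρ : ℝ) (hθ : θ ∈ Set.Icc (0 : ℝ) 1) :
    Tendsto (fun n : ℕ => Nlam μ₁ μ₂ θ ρ n / n) atTop
      (nhds (ρ * (θ * μ₁ + (1 - θ) * μ₂))) := by
  refine ((((tendsto_Npool1_div hθ.1).mul_const μ₁).add
    ((tendsto_Npool2_div hθ).mul_const μ₂)).const_mul ρ).congr fun n => ?_
  unfold Nlam
  ring

lemma tendsto_atTop_of_div_natCast {u : ℕ → ℝ} {c : ℝ} (hc : 0 < c)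
    (hu : Tendsto (fun n : ℕ => u n / n) atTop (nhds c)) : Tendsto u atTop atTop := by
  refine (hu.pos_mul_atTop hc tendsto_natCast_atTop_atTop).congr' ?_
  filter_upwards [eventually_gt_atTop 0] with n hn
  have : (n : ℝ) ≠ 0 := by positivity
  field_simp

lemma Nlam_nonneg (hμ₁ : 0 ≤ μ₁) (hμ₂ : 0 ≤ μ₂) (hρ : 0 ≤ ρ) (n : ℕ) :
    0 ≤ Nlam μ₁ μ₂ θ ρ n := by
  unfold Nlam; positivity

/-- The roots of a convergent family of saddle point equations converge. -/
lemma tendsto_saddle_root (hμ₁ : 0 < μ₁) (hμ₂ : 0 < μ₂) {c₁ c₂ l T : ℝ} (hc₁ : 0 < c₁)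
    (hc₂ : 0 < c₂) (hT : 0 < T) (hroot : l = c₁ * (1 / μ₁ + T)⁻¹ + c₂ * (1 / μ₂ + T)⁻¹)
    {u v w t : ℕ → ℝ} (hu : Tendsto u atTop (nhds c₁)) (hv : Tendsto v atTop (nhds c₂))
    (hw : Tendsto w atTop (nhds l)) (ht : ∀ᶠ n in atTop, 0 < t n)
    (heq : ∀ᶠ n in atTop, w n = u n * (1 / μ₁ + t n)⁻¹ + v n * (1 / μ₂ + t n)⁻¹) :
    Tendsto t atTop (nhds T) := by
  have hlim : ∀ τ, Tendsto (fun n => u n * (1 / μ₁ + τ)⁻¹ + v n * (1 / μ₂ + τ)⁻¹ - w n) atTop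
      (nhds (c₁ * (1 / μ₁ + τ)⁻¹ + c₂ * (1 / μ₂ + τ)⁻¹ - l)) := fun τ =>
    ((hu.mul_const _).add (hv.mul_const _)).sub hw
  have hup : ∀ᶠ n in atTop, 0 ≤ u n := hu.eventually_const_le hc₁
  have hvp : ∀ᶠ n in atTop, 0 ≤ v n := hv.eventually_const_le hc₂
  have hanti : ∀ {x y m : ℝ}, 0 < m → 0 < x → x < y → (1 / m + y)⁻¹ < (1 / m + x)⁻¹ := by
    intro x y m hm hx hxy
    gcongr
  refine tendsto_order.2 ⟨fun τ hτ => ?_, fun τ hτ => ?_⟩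
  · rcases le_or_gt τ 0 with h0 | h0
    · filter_upwards [ht] with n hn using h0.trans_lt hn
    have hpos : 0 < c₁ * (1 / μ₁ + τ)⁻¹ + c₂ * (1 / μ₂ + τ)⁻¹ - l := by
      have := mul_lt_mul_of_pos_left (hanti hμ₁ h0 hτ) hc₁
      have := mul_lt_mul_of_pos_left (hanti hμ₂ h0 hτ) hc₂
      linarith
    filter_upwards [(hlim τ).eventually_const_lt hpos, ht, heq, hup, hvp] with n h1 h2 h3 h4 h5
    by_contra! hle
    have : (1 / μ₁ + τ)⁻¹ ≤ (1 / μ₁ + t n)⁻¹ := by gcongr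
    have := mul_le_mul_of_nonneg_left this h4
    have : (1 / μ₂ + τ)⁻¹ ≤ (1 / μ₂ + t n)⁻¹ := by gcongr
    have := mul_le_mul_of_nonneg_left this h5
    linarith
  · have hneg : c₁ * (1 / μ₁ + τ)⁻¹ + c₂ * (1 / μ₂ + τ)⁻¹ - l < 0 := by
      have := mul_lt_mul_of_pos_left (hanti hμ₁ hT hτ) hc₁
      have := mul_lt_mul_of_pos_left (hanti hμ₂ hT hτ) hc₂
      linarith
    have hτ0 : 0 < τ := hT.trans hτ
    filter_upwards [(hlim τ).eventually_lt_const hneg, ht, heq, hup, hvp] with n h1 h2 h3 h4 h5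
    by_contra! hle
    have : (1 / μ₁ + t n)⁻¹ ≤ (1 / μ₁ + τ)⁻¹ := by gcongr
    have := mul_le_mul_of_nonneg_left this h4
    have : (1 / μ₂ + t n)⁻¹ ≤ (1 / μ₂ + τ)⁻¹ := by gcongr
    have := mul_le_mul_of_nonneg_left this h5
    linarith

/-- The `k`-th slice of the N-system lies in the tilting regime. -/
lemma tiltRegime_Nsystem {T : ℝ} {Tn : ℕ → ℝ} (hμ₁ : 0 < μ₁) (hμ₂ : 0 < μ₂)
    (hθ : θ ∈ Set.Ioo (0 : ℝ) 1) (hρ : 0 < ρ) (hT : 0 < T)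
    (hTroot : ρ * (θ * μ₁ + (1 - θ) * μ₂)
        = θ * (1 / μ₁ + T)⁻¹ + (1 - θ) * (1 / μ₂ + T)⁻¹)
    (hTn : ∀ n : ℕ, 2 ≤ n → 0 < Tn n)
    (hTnroot : ∀ n : ℕ, 2 ≤ n →
        1 = ((Npool1 θ n : ℝ) / Nlam μ₁ μ₂ θ ρ n) * (1 / μ₁ + Tn n)⁻¹
          + ((Npool2 θ n : ℝ) / Nlam μ₁ μ₂ θ ρ n) * (1 / μ₂ + Tn n)⁻¹) (k : ℕ) :
    TiltRegime (fun n => Npool1 θ n - 1) (fun n => Npool2 θ n - k) 1 k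
      (fun n => μ₁ / Nlam μ₁ μ₂ θ ρ n) (fun n => μ₂ / Nlam μ₁ μ₂ θ ρ n)
      (fun n => Nlam μ₁ μ₂ θ ρ n * Tn n)
      (fun n => Tn n / (Tn n + 1 / μ₁)) (fun n => Tn n / (Tn n + 1 / μ₂))
      θ (1 - θ) (T / (T + 1 / μ₁)) (T / (T + 1 / μ₂)) := by
  have hθ' : θ ∈ Set.Icc (0 : ℝ) 1 := ⟨hθ.1.le, hθ.2.le⟩
  have hθ1 : 0 < 1 - θ := sub_pos.2 hθ.2
  have hl := tendsto_Nlam_div μ₁ μ₂ ρ hθ'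
  have hlpos : 0 < ρ * (θ * μ₁ + (1 - θ) * μ₂) := by have := hθ.1; positivity
  have hltop := tendsto_atTop_of_div_natCast hlpos hl
  have h1 := tendsto_Npool1_div hθ.1.le
  have h2 := tendsto_Npool2_div hθ'
  have hn1 : Tendsto (fun n => (Npool1 θ n : ℝ)) atTop atTop :=
    tendsto_atTop_of_div_natCast hθ.1 h1
  have hn2 : Tendsto (fun n => (Npool2 θ n : ℝ)) atTop atTop :=
    tendsto_atTop_of_div_natCast hθ1 h2
  have hT' : Tendsto Tn atTop (nhds T) := by
    refine tendsto_saddle_root hμ₁ hμ₂ hθ.1 hθ1 hT hTroot h1 h2 hl ?_ ?_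
    · filter_upwards [eventually_ge_atTop 2] with n hn using hTn n hn
    · filter_upwards [eventually_ge_atTop 2, hltop.eventually_gt_atTop 0] with n hn hl
      have h := congrArg (fun z => z * (Nlam μ₁ μ₂ θ ρ n / n)) (hTnroot n hn)
      simp only [one_mul] at h
      rw [h]
      field_simp
  have hsub : ∀ {N : ℕ → ℕ} {c : ℝ} (j : ℕ), Tendsto (fun n => (N n : ℝ)) atTop atTop →
      Tendsto (fun n => (N n : ℝ) / n) atTop (nhds c) →
      Tendsto (fun n => ((N n - j : ℕ) : ℝ) / n) atTop (nhds c) := by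
    intro N c j hN hNc
    have := hNc.sub (tendsto_const_div_atTop_nhds_zero_nat (j : ℝ))
    rw [sub_zero] at this
    refine this.congr' ?_
    filter_upwards [hN.eventually_ge_atTop (j : ℝ)] with n hn
    rw [Nat.cast_sub (by exact_mod_cast hn), sub_div]
  have hp : ∀ {m : ℝ}, 0 < m → Tendsto (fun n => Tn n / (Tn n + 1 / m)) atTop
      (nhds (T / (T + 1 / m))) := fun hm =>
    hT'.div (hT'.add_const _) (by positivity)
  have hP : ∀ {m : ℝ}, 0 < m → T / (T + 1 / m) ∈ Set.Ioo (0 : ℝ) 1 := by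
    intro m hm
    have : 0 < 1 / m := by positivity
    exact ⟨by positivity, (div_lt_one (by positivity)).2 (by linarith)⟩
  refine ⟨fun n => ?_, fun n => ?_, hθ.1, hθ1, hP hμ₁, hP hμ₂, hsub 1 hn1 h1, hsub k hn2 h2,
    hp hμ₁, hp hμ₂, ?_⟩
  · exact div_nonneg hμ₁.le (Nlam_nonneg hμ₁.le hμ₂.le hρ.le n)
  · exact div_nonneg hμ₂.le (Nlam_nonneg hμ₁.le hμ₂.le hρ.le n)
  filter_upwards [eventually_ge_atTop 2, hltop.eventually_gt_atTop 0,
    hn1.eventually_ge_atTop ((1 : ℕ) : ℝ), hn2.eventually_ge_atTop (k : ℝ)] with n hn hl hn1 hn2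
  have ht := hTn n hn
  refine ⟨by positivity, by field_simp; ring, by field_simp; ring, ?_⟩
  rw [Nat.cast_sub (by exact_mod_cast hn1), Nat.cast_sub (by exact_mod_cast hn2),
    sub_add_cancel, sub_add_cancel]
  have h := congrArg (fun z => Nlam μ₁ μ₂ θ ρ n * Tn n * z) (hTnroot n hn)
  simp only [mul_one] at h
  rw [h]
  field_simp
  ring

end asymptotics

section weights

variable {μ₁ μ₂ θ ρ α : ℝ} {n k : ℕ}

/-- The factor relating the N-system weights on the slice `K = k` to the mixture weights. -/
noncomputable def sliceFactor (μ₁ μ₂ θ ρ α : ℝ) (n k : ℕ) : ℝ :=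
  Npool1 θ n * ((Npool2 θ n).factorial / (Npool2 θ n - k).factorial : ℝ) * μ₁ * μ₂ ^ k *
    ((Nlam μ₁ μ₂ θ ρ n)⁻¹ ^ (k + 1) * (Nlam μ₁ μ₂ θ ρ n / (α * Nlam μ₁ μ₂ θ ρ n)) ^ k)

lemma Nwt_interior (hk : k ≤ Npool2 θ n) {i j : ℕ} (hi : i < Npool1 θ n)
    (hj : j < Npool2 θ n - k + 1) :
    Nwt μ₁ μ₂ θ ρ α n (k, i + 1, k + j) = sliceFactor μ₁ μ₂ θ ρ α n k *
      mixWeight (Npool1 θ n - 1) (Npool2 θ n - k) (μ₁ / Nlam μ₁ μ₂ θ ρ n)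
        (μ₂ / Nlam μ₁ μ₂ θ ρ n) (i, j) := by
  unfold Nwt sliceFactor mixWeight
  have hcond : k ≤ Npool2 θ n ∧ 1 ≤ i + 1 ∧ i + 1 ≤ Npool1 θ n ∧ k ≤ k + j ∧
    k + j ≤ Npool2 θ n := by omega
  simp only [if_pos hcond]
  generalize Nlam μ₁ μ₂ θ ρ n = l
  generalize Npool2 θ n = n₂ at *
  obtain ⟨n₁, hn₁⟩ : ∃ m, Npool1 θ n = m + 1 := ⟨Npool1 θ n - 1, by omega⟩
  rw [hn₁]
  have e1 : i + 1 + (k + j) - k - 1 = i + j := by omega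
  have e2 : k + j - k = j := by omega
  have c1 : ((n₁ + 1).choose (i + 1) : ℝ) * ((i + 1 : ℕ) : ℝ) = ((n₁ + 1 : ℕ) : ℝ) * n₁.choose i := by
    exact_mod_cast (Nat.add_one_mul_choose_eq n₁ i).symm
  have c2 : (n₂.choose (k + j) : ℝ) * ((k + j).factorial / j.factorial : ℝ) =
      (n₂.factorial / (n₂ - k).factorial : ℝ) * (n₂ - k).choose j := by
    rw [Nat.cast_choose ℝ (by omega : k + j ≤ n₂), Nat.cast_choose ℝ (by omega : j ≤ n₂ - k),
      Nat.sub_sub]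
    have := fun m : ℕ => (Nat.cast_pos (α := ℝ)).2 m.factorial_pos
    have h1 := (this (k + j)).ne'
    have h2 := (this (n₂ - k)).ne'
    field_simp
  rw [e1, e2, Nat.add_sub_cancel]
  calc _ = (((n₁ + 1).choose (i + 1) : ℝ) * ((i + 1 : ℕ) : ℝ)) *
        ((n₂.choose (k + j) : ℝ) * ((k + j).factorial / j.factorial : ℝ)) *
        ((i + j).factorial * μ₁ ^ (i + 1) * μ₂ ^ (k + j) * (l ^ (i + 1 + (k + j)))⁻¹ *
          (l / (α * l)) ^ k) := by ring
    _ = _ := by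
      rw [c1, c2]
      simp only [div_eq_mul_inv, mul_pow, ← inv_pow]
      ring

lemma Nwt_eq_zero {t : ℕ × ℕ × ℕ} (ht : t ∉ Finset.range (Npool2 θ n + 1) ×ˢ
    Finset.range (Npool1 θ n + 1) ×ˢ Finset.range (Npool2 θ n + 1)) :
    Nwt μ₁ μ₂ θ ρ α n t = 0 := by
  obtain ⟨k, i, j⟩ := t
  simp only [Finset.mem_product, Finset.mem_range] at ht
  unfold Nwt
  simp only
  rw [if_neg (by omega), if_neg (by omega), if_neg (by omega)]

lemma Nwt_slice_eq_zero_of_lt {i j : ℕ} (hj : j < k) :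
    Nwt μ₁ μ₂ θ ρ α n (k, i + 1, j) = 0 := by
  unfold Nwt
  simp only
  rw [if_neg (by omega), if_neg (by omega), if_neg (by omega)]

lemma Nwt_boundary_eq_zero {j : ℕ} (hj : k < j) :
    Nwt μ₁ μ₂ θ ρ α n (k, 0, j) = 0 := by
  unfold Nwt
  simp only
  rw [if_neg (by omega), if_neg (by omega), if_neg (by omega)]

lemma tsum_Nwt_slice (hn₁ : 1 ≤ Npool1 θ n) (hk : k ≤ Npool2 θ n) (p : ℕ × ℕ → Prop)
    [DecidablePred p] :
    ∑' t : {t : ℕ × ℕ × ℕ | t.1 = k ∧ p t.2}, Nwt μ₁ μ₂ θ ρ α n t =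
      sliceFactor μ₁ μ₂ θ ρ α n k * (∑ q ∈ mixBox (Npool1 θ n - 1) (Npool2 θ n - k),
        if p (q.1 + 1, q.2 + k) then mixWeight (Npool1 θ n - 1) (Npool2 θ n - k)
          (μ₁ / Nlam μ₁ μ₂ θ ρ n) (μ₂ / Nlam μ₁ μ₂ θ ρ n) q else 0) +
      ∑ j ∈ Finset.range (k + 1), if p (0, j) then Nwt μ₁ μ₂ θ ρ α n (k, 0, j) else 0 := by
  classical
  rw [tsum_subtype {t : ℕ × ℕ × ℕ | t.1 = k ∧ p t.2} (Nwt μ₁ μ₂ θ ρ α n)]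
  rw [tsum_eq_sum (s := {k} ×ˢ Finset.range (Npool1 θ n + 1) ×ˢ Finset.range (Npool2 θ n + 1))]
  · rw [Finset.sum_product, Finset.sum_singleton, Finset.sum_product, Finset.sum_range_succ']
    congr 1
    · rw [mixBox, Finset.sum_product, Finset.mul_sum, Nat.sub_add_cancel hn₁]
      refine Finset.sum_congr rfl fun i hi => ?_
      have hsplit : Npool2 θ n + 1 = k + (Npool2 θ n - k + 1) := by omega
      rw [hsplit, Finset.sum_range_add, Finset.sum_eq_zero, zero_add, Finset.mul_sum]
      · refine Finset.sum_congr rfl fun j hj => ?_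
        rw [Set.indicator_apply, Nwt_interior hk (Finset.mem_range.1 hi) (Finset.mem_range.1 hj)]
        simp [add_comm k j]
      · intro j hj
        rw [Set.indicator_apply, Nwt_slice_eq_zero_of_lt (Finset.mem_range.1 hj), ite_self]
    · have hsplit : Npool2 θ n + 1 = (k + 1) + (Npool2 θ n - k) := by omega
      rw [hsplit, Finset.sum_range_add,
        Finset.sum_eq_zero (s := Finset.range (Npool2 θ n - k)), add_zero]
      · refine Finset.sum_congr rfl fun j hj => ?_
        rw [Set.indicator_apply]
        simp
      · intro j hj
        rw [Set.indicator_apply, Nwt_boundary_eq_zero (by omega), ite_self]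
  · intro t ht
    rw [Set.indicator_apply]
    split_ifs with h
    · refine Nwt_eq_zero fun hmem => ht ?_
      simp only [Finset.mem_product, Finset.mem_singleton] at hmem ⊢
      exact ⟨h.1, hmem.2⟩
    · rfl

lemma add_mul_nonneg_of_mem_Icc (hμ₂ : 0 ≤ μ₂) (hθ : θ ≤ 1) (hk : k ≤ Npool2 θ n) {j m : ℕ}
    (hj : j ∈ Finset.Icc (n - k) m) :
    μ₁ * Npool1 θ n - (1 - α) * Nlam μ₁ μ₂ θ ρ n ≤
      μ₁ * (Npool1 θ n : ℝ) + μ₂ * ((j : ℝ) - (Npool1 θ n : ℝ)) -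
        (1 - α) * Nlam μ₁ μ₂ θ ρ n := by
  have hle : Npool1 θ n ≤ j := by
    have := (Finset.mem_Icc.1 hj).1
    have := Npool1_le hθ n
    unfold Npool2 at hk
    omega
  have : (0 : ℝ) ≤ (j : ℝ) - Npool1 θ n := sub_nonneg.2 (by exact_mod_cast hle)
  have := mul_nonneg hμ₂ this
  linarith

lemma Nwt_nonneg (hμ₁ : 0 ≤ μ₁) (hμ₂ : 0 ≤ μ₂) (hθ : θ ≤ 1) (hρ : 0 ≤ ρ) (hα : 0 ≤ α)
    (hD : 0 < μ₁ * Npool1 θ n - (1 - α) * Nlam μ₁ μ₂ θ ρ n)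
    (hg : 0 < μ₁ * Npool1 θ n + μ₂ * Npool2 θ n - Nlam μ₁ μ₂ θ ρ n) (t : ℕ × ℕ × ℕ) :
    0 ≤ Nwt μ₁ μ₂ θ ρ α n t := by
  obtain ⟨k, i, j⟩ := t
  have hl := Nlam_nonneg (θ := θ) hμ₁ hμ₂ hρ n
  have hprod : k ≤ Npool2 θ n → ∀ m, 0 ≤ ∏ j ∈ Finset.Icc (n - k) m,
      (μ₁ * (Npool1 θ n : ℝ) + μ₂ * ((j : ℝ) - (Npool1 θ n : ℝ)) -
        (1 - α) * Nlam μ₁ μ₂ θ ρ n)⁻¹ := fun hk m => Finset.prod_nonneg fun j hj =>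
    inv_nonneg.2 (hD.le.trans (add_mul_nonneg_of_mem_Icc hμ₂ hθ hk hj))
  unfold Nwt
  simp only
  split_ifs with h1 h2 h3
  · positivity
  · have := hprod h2.2.1 (n - j)
    positivity
  · have := hprod h3.1 (n - 1)
    positivity
  · exact le_rfl

lemma Nwt_boundary_le {M : ℝ} (hμ₁ : 0 ≤ μ₁) (hμ₂ : 0 ≤ μ₂) (hθ : θ ≤ 1)
    (hα : α ∈ Set.Ioc (0 : ℝ) 1) (hn : 1 ≤ n) (hk : k ≤ Npool2 θ n)
    (hl : 0 < Nlam μ₁ μ₂ θ ρ n) (hM : 1 ≤ M)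
    (hD : 0 < μ₁ * Npool1 θ n - (1 - α) * Nlam μ₁ μ₂ θ ρ n)
    (hDM : (μ₁ * Npool1 θ n - (1 - α) * Nlam μ₁ μ₂ θ ρ n)⁻¹ ≤ M * (Nlam μ₁ μ₂ θ ρ n)⁻¹)
    (hgM : (μ₁ * Npool1 θ n + μ₂ * Npool2 θ n - Nlam μ₁ μ₂ θ ρ n)⁻¹ ≤
      M * (Nlam μ₁ μ₂ θ ρ n)⁻¹) {j : ℕ} (hj : j ≤ k) :
    Nwt μ₁ μ₂ θ ρ α n (k, 0, j) ≤ sliceFactor μ₁ μ₂ θ ρ α n k * M ^ (k + 1) := by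
  have hα1 : 1 ≤ α⁻¹ := (one_le_inv₀ hα.1).2 hα.2
  have hkn : k ≤ n := hk.trans (Nat.sub_le _ _)
  have hprod : ∀ m, ∏ j ∈ Finset.Icc (n - k) m,
      (μ₁ * (Npool1 θ n : ℝ) + μ₂ * ((j : ℝ) - (Npool1 θ n : ℝ)) -
        (1 - α) * Nlam μ₁ μ₂ θ ρ n)⁻¹ ≤ (M * (Nlam μ₁ μ₂ θ ρ n)⁻¹) ^ (m + 1 - (n - k)) := by
    intro m
    rw [← Nat.card_Icc, ← Finset.prod_const]
    refine Finset.prod_le_prod (fun j hj => ?_) fun j hj => ?_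
    · exact inv_nonneg.2 (hD.le.trans (add_mul_nonneg_of_mem_Icc hμ₂ hθ hk hj))
    · exact (inv_anti₀ hD (add_mul_nonneg_of_mem_Icc hμ₂ hθ hk hj)).trans hDM
  have hprod0 : ∀ m, 0 ≤ ∏ j ∈ Finset.Icc (n - k) m,
      (μ₁ * (Npool1 θ n : ℝ) + μ₂ * ((j : ℝ) - (Npool1 θ n : ℝ)) -
        (1 - α) * Nlam μ₁ μ₂ θ ρ n)⁻¹ := fun m => Finset.prod_nonneg fun j hj =>
    inv_nonneg.2 (hD.le.trans (add_mul_nonneg_of_mem_Icc hμ₂ hθ hk hj))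
  have hratio : Nlam μ₁ μ₂ θ ρ n / (α * Nlam μ₁ μ₂ θ ρ n) = α⁻¹ := by
    field_simp
  have hs : sliceFactor μ₁ μ₂ θ ρ α n k * M ^ (k + 1) =
      Npool1 θ n * ((Npool2 θ n).factorial / (Npool2 θ n - k).factorial : ℝ) * μ₁ * μ₂ ^ k *
        ((M * (Nlam μ₁ μ₂ θ ρ n)⁻¹) ^ (k + 1) * α⁻¹ ^ k) := by
    rw [sliceFactor, hratio]
    ring
  rw [hs]
  unfold Nwt
  simp only
  rw [if_neg (by omega)]
  rcases Nat.eq_zero_or_pos j with rfl | hj0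
  · rw [if_neg (by omega), if_pos (by simp [hk]), mul_assoc _ (_⁻¹)]
    have h := hprod (n - 1)
    have h0 := hprod0 (n - 1)
    rw [show n - 1 + 1 - (n - k) = k by omega] at h
    refine mul_le_mul_of_nonneg_left ?_ (by positivity)
    calc _ ≤ (M * (Nlam μ₁ μ₂ θ ρ n)⁻¹) * (M * (Nlam μ₁ μ₂ θ ρ n)⁻¹) ^ k := by gcongr
      _ = (M * (Nlam μ₁ μ₂ θ ρ n)⁻¹) ^ (k + 1) * 1 := by ring
      _ ≤ _ := by
        gcongr
        exact one_le_pow₀ hα1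
  · rw [if_pos ⟨hj0.trans_le hj, hk, trivial, hj0, hj⟩, mul_assoc _ (_⁻¹)]
    have h := hprod (n - j)
    have h0 := hprod0 (n - j)
    rw [show n - j + 1 - (n - k) = k + 1 - j by omega] at h
    refine mul_le_mul_of_nonneg_left ?_ (by positivity)
    have hpow : ((α * Nlam μ₁ μ₂ θ ρ n) ^ j)⁻¹ ≤ (M * (Nlam μ₁ μ₂ θ ρ n)⁻¹) ^ j * α⁻¹ ^ k := by
      rw [← inv_pow, mul_inv, mul_pow, mul_comm]
      gcongr
      exact le_mul_of_one_le_left (by positivity) hM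
    calc _ ≤ ((M * (Nlam μ₁ μ₂ θ ρ n)⁻¹) ^ j * α⁻¹ ^ k) *
          (M * (Nlam μ₁ μ₂ θ ρ n)⁻¹) ^ (k + 1 - j) := by
          have : 0 ≤ α⁻¹ := by linarith
          gcongr
      _ = _ := by
        rw [show k + 1 = j + (k + 1 - j) by omega, pow_add, Nat.add_sub_cancel_left]
        ring

lemma sliceFactor_pos (hμ₁ : 0 < μ₁) (hμ₂ : 0 < μ₂) (hα : 0 < α) (hn₁ : 1 ≤ Npool1 θ n)
    (hl : 0 < Nlam μ₁ μ₂ θ ρ n) : 0 < sliceFactor μ₁ μ₂ θ ρ α n k := by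
  unfold sliceFactor
  have : (0 : ℝ) < Npool1 θ n := by exact_mod_cast hn₁
  positivity

lemma tsum_Nwt_pos (hμ₁ : 0 < μ₁) (hμ₂ : 0 < μ₂) (hθ : θ ≤ 1) (hρ : 0 ≤ ρ) (hα : 0 < α)
    (hn₁ : 1 ≤ Npool1 θ n) (hl : 0 < Nlam μ₁ μ₂ θ ρ n)
    (hD : 0 < μ₁ * Npool1 θ n - (1 - α) * Nlam μ₁ μ₂ θ ρ n)
    (hg : 0 < μ₁ * Npool1 θ n + μ₂ * Npool2 θ n - Nlam μ₁ μ₂ θ ρ n) :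
    0 < ∑' t, Nwt μ₁ μ₂ θ ρ α n t := by
  refine (summable_of_ne_finset_zero fun t ht => Nwt_eq_zero ht).tsum_pos
    (Nwt_nonneg hμ₁.le hμ₂.le hθ hρ hα.le hD hg) (0, 0 + 1, 0 + 0) ?_
  rw [Nwt_interior (Nat.zero_le _) hn₁ (by omega)]
  refine mul_pos (sliceFactor_pos hμ₁ hμ₂ hα hn₁ hl) ?_
  simp [mixWeight]

end weights

section correlation

variable {θ f₁ f₂ P Q σ₁ σ₂ r : ℝ}

/-- The covariance matrix of the limit, expressed through the binomial variances
`v₁ = θP(1 - P)`, `v₂ = (1 - θ)Q(1 - Q)` and the curvature `κ = θP² + (1 - θ)Q²`. -/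
lemma covariance_identities (hθ : θ ∈ Set.Ioo (0 : ℝ) 1) (hP : P ∈ Set.Ioo (0 : ℝ) 1)
    (hQ : Q ∈ Set.Ioo (0 : ℝ) 1) (hf₁ : f₁ = θ * P) (hf₂ : f₂ = (1 - θ) * Q)
    (hσ₁ : 0 ≤ σ₁)
    (hσ₁sq : σ₁ ^ 2 = (θ - f₁) * f₁ * ((1 - θ) * f₁ + f₂ ^ 2)
        / (θ * f₂ ^ 2 + (1 - θ) * f₁ ^ 2))
    (hσ₂ : 0 ≤ σ₂)
    (hσ₂sq : σ₂ ^ 2 = (1 - θ - f₂) * f₂ * (θ * f₂ + f₁ ^ 2)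
        / (θ * f₂ ^ 2 + (1 - θ) * f₁ ^ 2))
    (hr : r = Real.sqrt ((θ - f₁) * (1 - θ - f₂) * f₁ * f₂
        / ((θ * f₂ + f₁ ^ 2) * ((1 - θ) * f₁ + f₂ ^ 2)))) :
    0 < σ₁ ∧ 0 < σ₂ ∧ r ^ 2 < 1 ∧
      σ₁ ^ 2 = θ * P * (1 - P) + (θ * P * (1 - P)) ^ 2 / (θ * P ^ 2 + (1 - θ) * Q ^ 2) ∧
      σ₂ ^ 2 = (1 - θ) * Q * (1 - Q) +
        ((1 - θ) * Q * (1 - Q)) ^ 2 / (θ * P ^ 2 + (1 - θ) * Q ^ 2) ∧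
      r * σ₁ * σ₂ = θ * P * (1 - P) * ((1 - θ) * Q * (1 - Q)) /
        (θ * P ^ 2 + (1 - θ) * Q ^ 2) := by
  obtain ⟨hθ0, hθ1⟩ := hθ
  obtain ⟨hP0, hP1⟩ := hP
  obtain ⟨hQ0, hQ1⟩ := hQ
  obtain ⟨φ, rfl⟩ : ∃ φ, θ = 1 - φ := ⟨1 - θ, by ring⟩
  rw [sub_sub_cancel] at *
  have hφ0 : 0 < φ := by linarith
  generalize hψ : 1 - φ = ψ at *
  have hP' : 0 < 1 - P := by linarith
  have hQ' : 0 < 1 - Q := by linarith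
  have hx : ψ - ψ * P = ψ * (1 - P) := by ring
  have hy : φ - φ * Q = φ * (1 - Q) := by ring
  have hφψ : φ = 1 - ψ := by linarith
  subst hf₁ hf₂
  rw [hx] at *
  rw [hy] at *
  have hr0 : 0 ≤ r := hr ▸ Real.sqrt_nonneg _
  have hrsq : r ^ 2 = ψ * (1 - P) * (φ * (1 - Q)) * (ψ * P) * (φ * Q) /
      ((ψ * (φ * Q) + (ψ * P) ^ 2) * (φ * (ψ * P) + (φ * Q) ^ 2)) := by
    rw [hr, Real.sq_sqrt (by positivity)]
  refine ⟨?_, ?_, ?_, ?_, ?_, ?_⟩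
  · refine hσ₁.lt_of_ne' (sq_pos_iff.1 ?_)
    rw [hσ₁sq]
    positivity
  · refine hσ₂.lt_of_ne' (sq_pos_iff.1 ?_)
    rw [hσ₂sq]
    positivity
  · rw [hrsq, div_lt_one (by positivity)]
    have h1 : (1 - P) * (1 - Q) < 1 := mul_lt_one_of_nonneg_of_lt_one_left hP'.le (by linarith)
      (by linarith)
    have h2 : 0 < ψ * φ * (ψ * P) * (φ * Q) := by positivity
    have h3 := mul_lt_mul_of_pos_left h1 h2
    have h4 : 0 < ψ * (φ * Q) * (φ * Q) ^ 2 + (ψ * P) ^ 2 * (φ * (ψ * P)) +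
      (ψ * P) ^ 2 * (φ * Q) ^ 2 := by positivity
    nlinarith [h3, h4]
  · rw [hσ₁sq]
    field_simp
    rw [hφψ]
    ring
  · rw [hσ₂sq]
    field_simp
    rw [hφψ]
    ring
  · refine (pow_left_inj₀ (by positivity) (by positivity) two_ne_zero).1 ?_
    rw [mul_pow, mul_pow, hrsq, hσ₁sq, hσ₂sq]
    field_simp
    ring

/-- The bivariate normal density factors through the regression of the second coordinate. -/
lemma gaussianPDFReal_mul_gaussianPDFReal (hσ₁ : 0 < σ₁) (hσ₂ : 0 < σ₂) (hr : r ^ 2 < 1)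
    {v w : NNReal} (hv : (v : ℝ) = σ₁ ^ 2) (hw : (w : ℝ) = σ₂ ^ 2 * (1 - r ^ 2)) (x y : ℝ) :
    ProbabilityTheory.gaussianPDFReal 0 v x *
      ProbabilityTheory.gaussianPDFReal 0 w (y - r * σ₂ / σ₁ * x) =
    (2 * Real.pi * σ₁ * σ₂ * Real.sqrt (1 - r ^ 2))⁻¹ *
      Real.exp (-(x ^ 2 / σ₁ ^ 2 - 2 * r * x * y / (σ₁ * σ₂) + y ^ 2 / σ₂ ^ 2)
        / (2 * (1 - r ^ 2))) := by
  have hr' : 0 < 1 - r ^ 2 := by linarith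
  rw [ProbabilityTheory.gaussianPDFReal, ProbabilityTheory.gaussianPDFReal, hv, hw,
    mul_mul_mul_comm, ← Real.exp_add, ← mul_inv, ← Real.sqrt_mul (by positivity)]
  congr 2
  · rw [show 2 * Real.pi * σ₁ ^ 2 * (2 * Real.pi * (σ₂ ^ 2 * (1 - r ^ 2))) =
      (2 * Real.pi * σ₁ * σ₂) ^ 2 * (1 - r ^ 2) by ring, Real.sqrt_mul (by positivity),
      Real.sqrt_sq (by positivity)]
  · field_simp
    ring

end correlation

lemma tendsto_div_of_bounded_perturbation {c V W u u' : ℕ → ℝ} {B L : ℝ}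
    (hc : ∀ᶠ n in atTop, 0 < c n) (hW : Tendsto W atTop atTop)
    (hV : Tendsto (fun n => V n / W n) atTop (nhds L))
    (hu : ∀ᶠ n in atTop, 0 ≤ u n ∧ u n ≤ c n * B)
    (hu' : ∀ᶠ n in atTop, 0 ≤ u' n ∧ u' n ≤ c n * B) :
    Tendsto (fun n => (c n * V n + u n) / (c n * W n + u' n)) atTop (nhds L) := by
  have hsmall : ∀ {z : ℕ → ℝ}, (∀ᶠ n in atTop, 0 ≤ z n ∧ z n ≤ c n * B) →
      Tendsto (fun n => z n / (c n * W n)) atTop (nhds 0) := by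
    intro z hz
    refine tendsto_of_tendsto_of_tendsto_of_le_of_le' tendsto_const_nhds
      (hW.const_div_atTop B) ?_ ?_
    · filter_upwards [hz, hc, hW.eventually_gt_atTop 0] with n h1 h2 h3
      exact div_nonneg h1.1 (by positivity)
    · filter_upwards [hz, hc, hW.eventually_gt_atTop 0] with n h1 h2 h3
      rw [div_le_div_iff₀ (by positivity) h3]
      nlinarith [mul_le_mul_of_nonneg_right h1.2 h3.le]
  have := (hV.add (hsmall hu)).div ((hsmall hu').const_add 1) (by norm_num)
  simp only [add_zero, div_one] at this
  refine this.congr' ?_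
  filter_upwards [hc, hW.eventually_gt_atTop 0, hu'] with n h1 h2 h3
  have : c n * W n + u' n ≠ 0 := by have := h3.1; positivity
  simp only [Pi.div_apply]
  field_simp


/-- Theorem 4 (conditional central limit theorem): under stability and complete
resource pooling, conditional on `K = k`, the centered and `√n`-scaled idle
counts converge in distribution to a centered bivariate normal distribution
with standard deviations `σ₁, σ₂` and correlation `r`. -/
theorem conditional_clt
    (μ₁ μ₂ θ ρ α T f₁ f₂ β δ σ₁ σ₂ r : ℝ) (Tn : ℕ → ℝ)
    (hμ₁ : 0 < μ₁) (hμ₂ : 0 < μ₂)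
    (hθ : θ ∈ Set.Ioo (0 : ℝ) 1) (hρ : ρ ∈ Set.Ioo (0 : ℝ) 1)
    (hα : α ∈ Set.Ioc (0 : ℝ) 1)
    (hT : 0 < T)
    (hTroot : ρ * (θ * μ₁ + (1 - θ) * μ₂)
        = θ * (1 / μ₁ + T)⁻¹ + (1 - θ) * (1 / μ₂ + T)⁻¹)
    (hf₁ : f₁ = T * θ / (T + 1 / μ₁))
    (hf₂ : f₂ = T * (1 - θ) / (T + 1 / μ₂))
    (hβ : β = f₁ / (f₁ + f₂))
    (hδ : δ = (1 - α) * ρ * (θ * μ₁ + (1 - θ) * μ₂) / (θ * μ₁))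
    (hδ1 : δ < 1)
    (hpool : 1 < α + β)
    (hσ₁ : 0 ≤ σ₁)
    (hσ₁sq : σ₁ ^ 2 = (θ - f₁) * f₁ * ((1 - θ) * f₁ + f₂ ^ 2)
        / (θ * f₂ ^ 2 + (1 - θ) * f₁ ^ 2))
    (hσ₂ : 0 ≤ σ₂)
    (hσ₂sq : σ₂ ^ 2 = (1 - θ - f₂) * f₂ * (θ * f₂ + f₁ ^ 2)
        / (θ * f₂ ^ 2 + (1 - θ) * f₁ ^ 2))
    (hr : r = Real.sqrt ((θ - f₁) * (1 - θ - f₂) * f₁ * f₂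
        / ((θ * f₂ + f₁ ^ 2) * ((1 - θ) * f₁ + f₂ ^ 2))))
    (hTn : ∀ n : ℕ, 2 ≤ n → 0 < Tn n)
    (hTnroot : ∀ n : ℕ, 2 ≤ n →
        1 = ((Npool1 θ n : ℝ) / Nlam μ₁ μ₂ θ ρ n) * (1 / μ₁ + Tn n)⁻¹
          + ((Npool2 θ n : ℝ) / Nlam μ₁ μ₂ θ ρ n) * (1 / μ₂ + Tn n)⁻¹)
    (m₁ m₂ : ℕ → ℝ)
    (hm₁ : ∀ n, m₁ n = Tn n * (Npool1 θ n : ℝ) / (Tn n + 1 / μ₁))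
    (hm₂ : ∀ n, m₂ n = Tn n * (Npool2 θ n : ℝ) / (Tn n + 1 / μ₂)) :
    ∀ k : ℕ, ∀ a b : ℝ,
      Tendsto (fun n : ℕ =>
          NP μ₁ μ₂ θ ρ α n {t : ℕ × ℕ × ℕ | t.1 = k ∧
              (t.2.1 : ℝ) ≤ m₁ n + a * Real.sqrt n ∧
              (t.2.2 : ℝ) ≤ m₂ n + b * Real.sqrt n} /
            NP μ₁ μ₂ θ ρ α n {t : ℕ × ℕ × ℕ | t.1 = k})
        atTop (nhds (∫ x in Set.Iic a, ∫ y in Set.Iic b,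
          (2 * Real.pi * σ₁ * σ₂ * Real.sqrt (1 - r ^ 2))⁻¹ *
            Real.exp (-(x ^ 2 / σ₁ ^ 2 - 2 * r * x * y / (σ₁ * σ₂) + y ^ 2 / σ₂ ^ 2)
              / (2 * (1 - r ^ 2))))) := by
  classical
  intro k a b
  have hθ1 : 0 < 1 - θ := sub_pos.2 hθ.2
  have hθ' : θ ∈ Set.Icc (0 : ℝ) 1 := ⟨hθ.1.le, hθ.2.le⟩
  have H := tiltRegime_Nsystem hμ₁ hμ₂ hθ hρ.1 hT hTroot hTn hTnroot k
  -- parameters of the limit law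
  obtain ⟨hσ₁0, hσ₂0, hr1, hσ₁e, hσ₂e, hcov⟩ := covariance_identities hθ H.P₁_mem H.P₂_mem
    (by rw [hf₁]; ring) (by rw [hf₂]; ring) hσ₁ hσ₁sq hσ₂ hσ₂sq hr
  have hr1' : 0 < 1 - r ^ 2 := by linarith
  let v : NNReal := ⟨σ₁ ^ 2, by positivity⟩
  let w : NNReal := ⟨σ₂ ^ 2 * (1 - r ^ 2), by positivity⟩
  have hv : (v : ℝ) = σ₁ ^ 2 := rfl
  have hw : (w : ℝ) = σ₂ ^ 2 * (1 - r ^ 2) := rfl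
  have hv0 : v ≠ 0 := by rw [← NNReal.coe_ne_zero, hv]; positivity
  have hw0 : w ≠ 0 := by rw [← NNReal.coe_ne_zero, hw]; positivity
  have hlaw := H.tendsto_law_lowerQuadrant (v := v) (w := w) (s := r * σ₂ / σ₁) hv0 hw0
    (fun ξ η => by
      have hcalc : σ₁ ^ 2 * (ξ + r * σ₂ / σ₁ * η) ^ 2 + σ₂ ^ 2 * (1 - r ^ 2) * η ^ 2 =
          σ₁ ^ 2 * ξ ^ 2 + 2 * (r * σ₁ * σ₂) * ξ * η + σ₂ ^ 2 * η ^ 2 := by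
        field_simp
        ring
      rw [hv, hw, hcalc, hσ₁e, hσ₂e, hcov]
      ring) a b
  rw [bivariateGaussian_real_lowerQuadrant hv0 hw0] at hlaw
  simp only [gaussianPDFReal_mul_gaussianPDFReal hσ₁0 hσ₂0 hr1 hv hw] at hlaw
  -- asymptotics of the parameters
  have hl := tendsto_Nlam_div μ₁ μ₂ ρ hθ'
  have hS : 0 < θ * μ₁ + (1 - θ) * μ₂ := by have := hθ.1; positivity
  have hlpos : 0 < ρ * (θ * μ₁ + (1 - θ) * μ₂) := mul_pos hρ.1 hS
  have h1 := tendsto_Npool1_div hθ.1.le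
  have h2 := tendsto_Npool2_div hθ'
  have hDlim : Tendsto (fun n : ℕ => (μ₁ * Npool1 θ n - (1 - α) * Nlam μ₁ μ₂ θ ρ n) / n) atTop
      (nhds (μ₁ * θ - (1 - α) * (ρ * (θ * μ₁ + (1 - θ) * μ₂)))) :=
    ((h1.const_mul μ₁).sub (hl.const_mul (1 - α))).congr fun n => by ring
  have hglim : Tendsto (fun n : ℕ => (μ₁ * Npool1 θ n + μ₂ * Npool2 θ n -
      Nlam μ₁ μ₂ θ ρ n) / n) atTop
      (nhds (μ₁ * θ + μ₂ * (1 - θ) - ρ * (θ * μ₁ + (1 - θ) * μ₂))) :=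
    (((h1.const_mul μ₁).add (h2.const_mul μ₂)).sub hl).congr fun n => by ring
  have hDpos : 0 < μ₁ * θ - (1 - α) * (ρ * (θ * μ₁ + (1 - θ) * μ₂)) := by
    rw [hδ, div_lt_one (mul_pos hθ.1 hμ₁)] at hδ1
    linarith
  have hgpos : 0 < μ₁ * θ + μ₂ * (1 - θ) - ρ * (θ * μ₁ + (1 - θ) * μ₂) := by
    have := mul_lt_mul_of_pos_right hρ.2 hS
    linarith
  obtain ⟨M, hM1, hMD, hMg⟩ : ∃ M : ℝ, 1 ≤ M ∧
      ρ * (θ * μ₁ + (1 - θ) * μ₂) / (μ₁ * θ - (1 - α) * (ρ * (θ * μ₁ + (1 - θ) * μ₂))) < M ∧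
      ρ * (θ * μ₁ + (1 - θ) * μ₂) /
        (μ₁ * θ + μ₂ * (1 - θ) - ρ * (θ * μ₁ + (1 - θ) * μ₂)) < M := by
    have h1 : ρ * (θ * μ₁ + (1 - θ) * μ₂) / (μ₁ * θ - (1 - α) *
        (ρ * (θ * μ₁ + (1 - θ) * μ₂))) > 0 := div_pos hlpos hDpos
    have h2 : ρ * (θ * μ₁ + (1 - θ) * μ₂) / (μ₁ * θ + μ₂ * (1 - θ) -
        ρ * (θ * μ₁ + (1 - θ) * μ₂)) > 0 := div_pos hlpos hgpos
    exact ⟨1 + _ + _, by linarith, lt_add_of_lt_of_pos (lt_one_add _) h2,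
      lt_add_of_pos_left _ (by linarith)⟩
  have hbound : ∀ᶠ n : ℕ in atTop, 1 ≤ n ∧ 1 ≤ Npool1 θ n ∧ k ≤ Npool2 θ n ∧
      0 < Nlam μ₁ μ₂ θ ρ n ∧ 0 < μ₁ * Npool1 θ n - (1 - α) * Nlam μ₁ μ₂ θ ρ n ∧
      0 < μ₁ * Npool1 θ n + μ₂ * Npool2 θ n - Nlam μ₁ μ₂ θ ρ n ∧
      (μ₁ * Npool1 θ n - (1 - α) * Nlam μ₁ μ₂ θ ρ n)⁻¹ ≤ M * (Nlam μ₁ μ₂ θ ρ n)⁻¹ ∧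
      (μ₁ * Npool1 θ n + μ₂ * Npool2 θ n - Nlam μ₁ μ₂ θ ρ n)⁻¹ ≤
        M * (Nlam μ₁ μ₂ θ ρ n)⁻¹ := by
    have hconv : ∀ {x l : ℝ} {n : ℕ}, (0 : ℝ) < n → 0 < l → l / n / (x / n) < M →
        x⁻¹ ≤ M * l⁻¹ := by
      intro x l n hn hl h
      rw [div_div_div_cancel_right₀ hn.ne'] at h
      rw [← div_eq_mul_inv, le_div_iff₀ hl, mul_comm, ← div_eq_mul_inv]
      exact h.le
    filter_upwards [eventually_ge_atTop 1,
      (tendsto_atTop_of_div_natCast hθ.1 h1).eventually_ge_atTop ((1 : ℕ) : ℝ),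
      (tendsto_atTop_of_div_natCast hθ1 h2).eventually_ge_atTop (k : ℝ),
      (tendsto_atTop_of_div_natCast hlpos hl).eventually_gt_atTop 0,
      (tendsto_atTop_of_div_natCast hDpos hDlim).eventually_gt_atTop 0,
      (tendsto_atTop_of_div_natCast hgpos hglim).eventually_gt_atTop 0,
      (hl.div hDlim hDpos.ne').eventually_lt_const hMD,
      (hl.div hglim hgpos.ne').eventually_lt_const hMg] with n a1 a2 a3 a4 a5 a6 a7 a8
    have hn : (0 : ℝ) < n := by exact_mod_cast a1
    exact ⟨a1, by exact_mod_cast a2, by exact_mod_cast a3, a4, a5, a6, hconv hn a4 a7,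
      hconv hn a4 a8⟩
  -- the boundary states carry a bounded multiple of the slice factor
  have hboundary : ∀ p : ℕ → ℕ × ℕ → Prop, ∀ᶠ n : ℕ in atTop,
      0 ≤ ∑ j ∈ Finset.range (k + 1), (if p n (0, j) then Nwt μ₁ μ₂ θ ρ α n (k, 0, j) else 0) ∧
      ∑ j ∈ Finset.range (k + 1), (if p n (0, j) then Nwt μ₁ μ₂ θ ρ α n (k, 0, j) else 0) ≤
        sliceFactor μ₁ μ₂ θ ρ α n k * ((k + 1 : ℕ) * M ^ (k + 1)) := by
    intro p
    filter_upwards [hbound] with n ⟨a1, a2, a3, a4, a5, a6, a7, a8⟩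
    have hnn := Nwt_nonneg hμ₁.le hμ₂.le hθ.2.le hρ.1.le hα.1.le a5 a6
    refine ⟨Finset.sum_nonneg fun j _ => by split_ifs; exacts [hnn _, le_rfl], ?_⟩
    have hle : ∀ j ∈ Finset.range (k + 1),
        (if p n (0, j) then Nwt μ₁ μ₂ θ ρ α n (k, 0, j) else 0) ≤
          sliceFactor μ₁ μ₂ θ ρ α n k * M ^ (k + 1) := by
      intro j hj
      have := Nwt_boundary_le hμ₁.le hμ₂.le hθ.2.le hα a1 a3 a4 hM1 a5 a7 a8
        (Nat.lt_succ_iff.1 (Finset.mem_range.1 hj))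
      split_ifs
      exacts [this, (hnn _).trans this]
    refine (Finset.sum_le_card_nsmul _ _ _ hle).trans_eq ?_
    rw [Finset.card_range, nsmul_eq_mul]
    ring
  have hmain := tendsto_div_of_bounded_perturbation
    (c := fun n => sliceFactor μ₁ μ₂ θ ρ α n k)
    (by filter_upwards [hbound] with n hn using
      sliceFactor_pos hμ₁ hμ₂ hα.1 hn.2.1 hn.2.2.2.1)
    H.tendsto_sum_mixWeight_atTop
    (hlaw.congr fun n => by
      rw [TiltRegime.law, weightedDirac_real
        (fun q _ => mixWeight_nonneg (H.a_nonneg n) (H.b_nonneg n) q)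
        (sum_mixWeight_pos (H.a_nonneg n) (H.b_nonneg n))])
    (hboundary fun n q => (q.1 : ℝ) ≤ m₁ n + a * Real.sqrt n ∧
      (q.2 : ℝ) ≤ m₂ n + b * Real.sqrt n)
    (hboundary fun _ _ => True)
  refine hmain.congr' ?_
  filter_upwards [hbound] with n ⟨a1, a2, a3, a4, a5, a6, a7, a8⟩
  have hZ := tsum_Nwt_pos hμ₁ hμ₂ hθ.2.le hρ.1.le hα.1 a2 a4 a5 a6
  have hsn : 0 < Real.sqrt n := Real.sqrt_pos.2 (by exact_mod_cast a1)
  have hslice : {t : ℕ × ℕ × ℕ | t.1 = k} = {t | t.1 = k ∧ True} := by simp only [and_true]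
  have hevent : ∀ {x m c : ℝ}, (Real.sqrt n)⁻¹ * (x - m) ≤ c ↔
      x ≤ m + c * Real.sqrt n := by
    intro x m c
    rw [inv_mul_le_iff₀ hsn]
    constructor <;> intro h <;> linarith
  rw [hslice, NP, NP, div_div_div_cancel_right₀ hZ.ne', tsum_Nwt_slice a2 a3 fun _ => True,
    tsum_Nwt_slice a2 a3 fun q : ℕ × ℕ =>
      (q.1 : ℝ) ≤ m₁ n + a * Real.sqrt n ∧ (q.2 : ℝ) ≤ m₂ n + b * Real.sqrt n]
  have hc1 : ((Npool1 θ n - 1 : ℕ) : ℝ) + (1 : ℕ) = Npool1 θ n := by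
    exact_mod_cast Nat.sub_add_cancel a2
  have hc2 : ((Npool2 θ n - k : ℕ) : ℝ) + k = Npool2 θ n := by
    exact_mod_cast Nat.sub_add_cancel a3
  have hm1' : (Npool1 θ n : ℝ) * (Tn n / (Tn n + 1 / μ₁)) = m₁ n := by rw [hm₁]; ring
  have hm2' : (Npool2 θ n : ℝ) * (Tn n / (Tn n + 1 / μ₂)) = m₂ n := by rw [hm₂]; ring
  simp only [TiltRegime.position, lowerQuadrant, Set.mem_inter_iff, Set.mem_ofPred_eq, hc1, hc2, hm1',
    hm2', WithLp.toLp_fst, WithLp.toLp_snd, hevent, if_true, Nat.cast_add]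
  congr!
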